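/- arXiv:1801.04893 — 7 statements merged into one kernel-verified Lean document; each statement's English description precedes it below -/
import Mathlib

section
/- Let k be a perfect field of characteristic p > 2, let R = k[x₀,…,x_n] be a polynomial ring, and let f ∈ R be nonzero with level m ≥ 2. Then the principal ideal (f) has an F-jumping exponent in the half-open interval (1 − p^{−(m−2)}, 1 − p^{−(m−1)}] and has no F-jumping exponent in the open interval (1 − p^{−(m−1)}, 1). Consequently there is a largest F-jumping exponent e of (f) in the interval (0,1), it lies in (1 − p^{−(m−2)}, 1 − p^{−(m−1)}], and m = ⌈1 − log_p(1 − e)⌉. -/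
/-- The bracket power `J^{[q]}` of an ideal: the ideal generated by `q`-th powers
of elements of `J`. -/
noncomputable def bracketPow {R : Type*} [CommRing R] (J : Ideal R) (q : ℕ) : Ideal R :=
  Ideal.span ((fun a => a ^ q) '' (J : Set R))

/-- The `p^e`-th root ideal `(g)^{[1/q]}`: the smallest ideal `J` with `g ∈ J^{[q]}`. -/
noncomputable def rootIdeal {R : Type*} [CommRing R] (g : R) (q : ℕ) : Ideal R :=
  sInf {J : Ideal R | g ∈ bracketPow J q}

/-- The descending chain of ideals `(f^{p^e-1})^{[1/p^e]}`. -/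
noncomputable def levelChain {R : Type*} [CommRing R] (f : R) (p : ℕ) (e : ℕ) : Ideal R :=
  rootIdeal (f ^ (p ^ e - 1)) (p ^ e)

/-- The level of `f`: `e + 1` where `e` is the least index at which the chain
`(f^{p^e-1})^{[1/p^e]}` becomes constant. -/
noncomputable def level {R : Type*} [CommRing R] (f : R) (p : ℕ) : ℕ :=
  sInf {e : ℕ | ∀ e', e ≤ e' → levelChain f p e' = levelChain f p e} + 1

/-- The generalised test ideal `τ(f^λ)`: the stable (= supremum) value of the
ascending chain `((f^{⌈λ p^e⌉}))^{[1/p^e]}`. -/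
noncomputable def testIdeal {R : Type*} [CommRing R] (f : R) (p : ℕ) (lam : ℝ) : Ideal R :=
  ⨆ e : ℕ, rootIdeal (f ^ ⌈lam * (p : ℝ) ^ e⌉₊) (p ^ e)

/-- `λ > 0` is an `F`-jumping exponent of `(f)` if `τ(f^λ') ≠ τ(f^λ)` for all
`0 < λ' < λ`. -/
def IsFJumpingExponent {R : Type*} [CommRing R] (f : R) (p : ℕ) (lam : ℝ) : Prop :=
  0 < lam ∧ ∀ lam' : ℝ, 0 < lam' → lam' < lam → testIdeal f p lam' ≠ testIdeal f p lam

section BracketPow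

variable {R : Type*} [CommRing R]

theorem bracketPow_mul_le (J : Ideal R) (q r : ℕ) :
    bracketPow J (q * r) ≤ bracketPow (bracketPow J q) r := by
  refine Ideal.span_le.2 ?_
  rintro _ ⟨a, ha, rfl⟩
  exact Ideal.subset_span ⟨a ^ q, Ideal.subset_span ⟨a, ha, rfl⟩, (pow_mul a q r).symm⟩

theorem pow_mem_bracketPow_mul {p : ℕ} [Fact p.Prime] [CharP R p] {J : Ideal R} {q : ℕ} {x : R}
    (hx : x ∈ bracketPow J q) (j : ℕ) : x ^ p ^ j ∈ bracketPow J (q * p ^ j) := by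
  induction hx using Submodule.span_induction with
  | mem x h =>
    obtain ⟨a, ha, rfl⟩ := h
    exact Ideal.subset_span ⟨a, ha, pow_mul a q _⟩
  | zero => simp [zero_pow (pow_ne_zero j (Fact.out : p.Prime).ne_zero)]
  | add x y _ _ hx hy =>
    rw [add_pow_char_pow]
    exact add_mem hx hy
  | smul a x _ hx =>
    rw [smul_eq_mul, mul_pow]
    exact Ideal.mul_mem_left _ _ hx

theorem rootIdeal_le {g : R} {q : ℕ} {J : Ideal R} (h : g ∈ bracketPow J q) :
    rootIdeal g q ≤ J :=
  sInf_le h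

theorem rootIdeal_pow_anti (f : R) (q : ℕ) : Antitone fun r : ℕ => rootIdeal (f ^ r) q :=
  fun _ _ hrs => le_sInf fun J hJ =>
    rootIdeal_le ((bracketPow J q).mem_of_dvd (pow_dvd_pow f hrs) hJ)

theorem testIdeal_antitone (f : R) (p : ℕ) : Antitone (testIdeal f p) := fun _ _ h =>
  iSup_mono fun _ => rootIdeal_pow_anti f _ (by gcongr)

end BracketPow

section FrobeniusBasis

variable {σ k : Type*} [Field k] {p : ℕ} [Fact p.Prime] [CharP k p] [PerfectRing k p]

open MvPolynomial

open scoped Classical in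
/-- The coordinate of a polynomial along `x ^ α` in the basis of `k[x]` over its subring of
`p ^ e`-th powers given by the monomials with exponents `< p ^ e`, followed by the `p ^ e`-th
root. -/
noncomputable def frobeniusCoord (p : ℕ) [Fact p.Prime] [CharP k p] [PerfectRing k p] (e : ℕ)
    (α : σ →₀ ℕ) : MvPolynomial σ k →+ MvPolynomial σ k where
  toFun g := ∑ γ ∈ g.support, if γ.mapRange (· % p ^ e) (Nat.zero_mod _) = α then
    monomial (γ.mapRange (· / p ^ e) (Nat.zero_div _))
      ((iterateFrobeniusEquiv k p e).symm (g.coeff γ)) else 0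
  map_zero' := by simp
  map_add' g h := by
    have extend (u : MvPolynomial σ k) (hu : u.support ⊆ g.support ∪ h.support) := by
      refine Finset.sum_subset (f := fun γ => if γ.mapRange (· % p ^ e) (Nat.zero_mod _) = α then
        monomial (γ.mapRange (· / p ^ e) (Nat.zero_div _))
          ((iterateFrobeniusEquiv k p e).symm (u.coeff γ)) else 0) hu fun γ _ hγ => ?_
      simp [notMem_support_iff.1 hγ]
    rw [extend g Finset.subset_union_left, extend h Finset.subset_union_right,
      extend (g + h) support_add, ← Finset.sum_add_distrib]
    refine Finset.sum_congr rfl fun γ _ => ?_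
    split_ifs <;> simp

open scoped Classical in
theorem frobeniusCoord_monomial (e : ℕ) (α γ : σ →₀ ℕ) (c : k) :
    frobeniusCoord p e α (monomial γ c) =
      if γ.mapRange (· % p ^ e) (Nat.zero_mod _) = α then
        monomial (γ.mapRange (· / p ^ e) (Nat.zero_div _))
          ((iterateFrobeniusEquiv k p e).symm c) else 0 := by
  by_cases hc : c = 0
  · simp [hc]
  · simp [frobeniusCoord, support_monomial, hc]

theorem frobeniusCoord_pow_mul (e : ℕ) (α : σ →₀ ℕ) (h g : MvPolynomial σ k) :
    frobeniusCoord p e α (h ^ p ^ e * g) = h * frobeniusCoord p e α g := by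
  have hp : 0 < p ^ e := pow_pos (Fact.out : p.Prime).pos e
  induction h using MvPolynomial.induction_on' with
  | add h₁ h₂ ih₁ ih₂ => rw [add_pow_char_pow, add_mul, map_add, ih₁, ih₂, add_mul]
  | monomial β b =>
    induction g using MvPolynomial.induction_on' with
    | add g₁ g₂ ih₁ ih₂ => rw [mul_add, map_add, ih₁, ih₂, map_add, mul_add]
    | monomial γ c =>
      have hmod : (p ^ e • β + γ).mapRange (· % p ^ e) (Nat.zero_mod _) =
          γ.mapRange (· % p ^ e) (Nat.zero_mod _) := by
        ext i
        simp
      have hdiv : (p ^ e • β + γ).mapRange (· / p ^ e) (Nat.zero_div _) =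
          β + γ.mapRange (· / p ^ e) (Nat.zero_div _) := by
        ext i
        simp [Nat.mul_add_div hp]
      have hroot : (iterateFrobeniusEquiv k p e).symm (b ^ p ^ e * c) =
          b * (iterateFrobeniusEquiv k p e).symm c := by
        rw [map_mul, ← iterateFrobeniusEquiv_def, RingEquiv.symm_apply_apply]
      rw [monomial_pow, monomial_mul, frobeniusCoord_monomial, frobeniusCoord_monomial, hmod,
        hdiv, hroot, mul_ite, mul_zero, monomial_mul]

theorem frobeniusCoord_mem {e : ℕ} {g : MvPolynomial σ k} {J : Ideal (MvPolynomial σ k)}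
    (hg : g ∈ bracketPow J (p ^ e)) (α : σ →₀ ℕ) : frobeniusCoord p e α g ∈ J := by
  rw [bracketPow, Ideal.span] at hg
  induction hg using Submodule.closure_induction with
  | zero => simp
  | add x y _ _ hx hy =>
    rw [map_add]
    exact add_mem hx hy
  | smul_mem r x hx =>
    obtain ⟨a, ha, rfl⟩ := hx
    rw [smul_eq_mul, mul_comm]
    dsimp only
    rw [frobeniusCoord_pow_mul]
    exact J.mul_mem_right _ ha

theorem sum_frobeniusCoord_pow_mul_monomial [Fintype σ] [DecidableEq σ] (e : ℕ)
    (g : MvPolynomial σ k) :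
    ∑ α ∈ Fintype.piFinset fun _ : σ => Finset.range (p ^ e),
      frobeniusCoord p e (Finsupp.equivFunOnFinite.symm α) g ^ p ^ e *
        monomial (Finsupp.equivFunOnFinite.symm α) 1 = g := by
  have hp : 0 < p ^ e := pow_pos (Fact.out : p.Prime).pos e
  induction g using MvPolynomial.induction_on' with
  | add g h ihg ihh =>
    simp only [map_add, add_pow_char_pow, add_mul, Finset.sum_add_distrib, ihg, ihh]
  | monomial γ c =>
    rw [Finset.sum_eq_single (fun i => γ i % p ^ e)]
    · have hα : (Finsupp.equivFunOnFinite.symm fun i => γ i % p ^ e) =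
          γ.mapRange (· % p ^ e) (Nat.zero_mod _) := by
        ext i
        simp
      have hγ : p ^ e • γ.mapRange (· / p ^ e) (Nat.zero_div _) +
          γ.mapRange (· % p ^ e) (Nat.zero_mod _) = γ := by
        ext i
        simp [Nat.div_add_mod]
      rw [hα, frobeniusCoord_monomial, if_pos rfl, monomial_pow, monomial_mul, hγ, mul_one,
        ← iterateFrobeniusEquiv_def, RingEquiv.apply_symm_apply]
    · intro α _ hα
      rw [frobeniusCoord_monomial, if_neg, zero_pow hp.ne', zero_mul]
      rintro h
      refine hα (funext fun i => ?_)
      simpa using (DFunLike.congr_fun h i).symm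
    · intro h
      exact absurd (Fintype.mem_piFinset.2 fun i => Finset.mem_range.2 (Nat.mod_lt _ hp)) h

theorem mem_bracketPow_iff [Finite σ] {e : ℕ} {g : MvPolynomial σ k}
    {J : Ideal (MvPolynomial σ k)} :
    g ∈ bracketPow J (p ^ e) ↔ ∀ α, frobeniusCoord p e α g ∈ J := by
  classical
  have := Fintype.ofFinite σ
  refine ⟨frobeniusCoord_mem, fun h => ?_⟩
  rw [← sum_frobeniusCoord_pow_mul_monomial (p := p) e g]
  exact sum_mem fun α _ => Ideal.mul_mem_right _ _ (Ideal.subset_span ⟨_, h _, rfl⟩)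

theorem mem_bracketPow_rootIdeal [Finite σ] (e : ℕ) (g : MvPolynomial σ k) :
    g ∈ bracketPow (rootIdeal g (p ^ e)) (p ^ e) :=
  mem_bracketPow_iff.2 fun α => Ideal.mem_sInf.2 fun _ hJ => frobeniusCoord_mem hJ α

/-- If `p ^ e` exceeds the degree of `f ≠ 0`, then some coordinate of `f` is a nonzero constant. -/
theorem exists_frobeniusCoord_eq_C {e : ℕ} {f : MvPolynomial σ k} (hf : f ≠ 0)
    (he : f.totalDegree < p ^ e) :
    ∃ α : σ →₀ ℕ, ∃ c : k, c ≠ 0 ∧ frobeniusCoord p e α f = C c := by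
  obtain ⟨α, hα⟩ := support_nonempty.2 hf
  have lt {γ : σ →₀ ℕ} (hγ : γ ∈ f.support) (i : σ) : γ i < p ^ e :=
    ((monomial_le_degreeOf i hγ).trans (degreeOf_le_totalDegree f i)).trans_lt he
  have mod {γ : σ →₀ ℕ} (hγ : γ ∈ f.support) : γ.mapRange (· % p ^ e) (Nat.zero_mod _) = γ := by
    ext i
    simp [Nat.mod_eq_of_lt (lt hγ i)]
  refine ⟨α, (iterateFrobeniusEquiv k p e).symm (f.coeff α), by simpa using hα, ?_⟩
  conv_lhs => rw [f.as_sum, map_sum]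
  rw [Finset.sum_eq_single_of_mem α hα]
  · have hdiv : α.mapRange (· / p ^ e) (Nat.zero_div _) = 0 := by
      ext i
      simp [Nat.div_eq_of_lt (lt hα i)]
    rw [frobeniusCoord_monomial, if_pos (mod hα), hdiv, C_apply]
  · intro γ hγ hne
    rw [frobeniusCoord_monomial, if_neg (by rwa [mod hγ])]

theorem mem_of_pow_mul_mem_bracketPow {e : ℕ} {f a : MvPolynomial σ k} (hf : f ≠ 0)
    (he : f.totalDegree < p ^ e) {J : Ideal (MvPolynomial σ k)}
    (h : a ^ p ^ e * f ∈ bracketPow J (p ^ e)) : a ∈ J := by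
  obtain ⟨α, c, hc, hα⟩ := exists_frobeniusCoord_eq_C (p := p) hf he
  have := frobeniusCoord_mem h α
  rw [frobeniusCoord_pow_mul, hα] at this
  exact (J.mul_unit_mem_iff_mem ((isUnit_iff_ne_zero.2 hc).map C)).1 this

end FrobeniusBasis

section TestIdeal

variable {σ k : Type*} [Field k] {p : ℕ} [Fact p.Prime] [CharP k p] [PerfectRing k p]

open MvPolynomial

theorem rootIdeal_pow_mul (f : MvPolynomial σ k) (r e j : ℕ) :
    rootIdeal (f ^ (r * p ^ j)) (p ^ (e + j)) = rootIdeal (f ^ r) (p ^ e) := by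
  rw [pow_mul, pow_add]
  refine le_antisymm (le_sInf fun J hJ => rootIdeal_le (pow_mem_bracketPow_mul hJ j))
    (le_sInf fun J hJ => rootIdeal_le ?_)
  refine mem_of_pow_mul_mem_bracketPow (p := p) (e := j) one_ne_zero ?_
    (by simpa using bracketPow_mul_le J _ _ hJ)
  simpa using pow_pos (Fact.out : p.Prime).pos j

theorem rootIdeal_ceil_mono (f : MvPolynomial σ k) (lam : ℝ) :
    Monotone fun e : ℕ => rootIdeal (f ^ ⌈lam * (p : ℝ) ^ e⌉₊) (p ^ e) := by
  refine monotone_nat_of_le_succ fun e => ?_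
  rw [← rootIdeal_pow_mul f _ e 1]
  refine rootIdeal_pow_anti f _ (Nat.ceil_le.2 ?_)
  push_cast
  rw [pow_succ, pow_one, ← mul_assoc]
  gcongr
  exact Nat.le_ceil _

theorem testIdeal_div_pow (f : MvPolynomial σ k) (r e : ℕ) :
    testIdeal f p ((r : ℝ) / (p : ℝ) ^ e) = rootIdeal (f ^ r) (p ^ e) := by
  have hp : (p : ℝ) ≠ 0 := Nat.cast_ne_zero.2 (Fact.out : p.Prime).ne_zero
  have key (j : ℕ) : rootIdeal (f ^ ⌈(r : ℝ) / (p : ℝ) ^ e * (p : ℝ) ^ (e + j)⌉₊) (p ^ (e + j)) =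
      rootIdeal (f ^ r) (p ^ e) := by
    rw [← rootIdeal_pow_mul f r e j, pow_add, ← mul_assoc, div_mul_cancel₀ _ (pow_ne_zero e hp)]
    norm_cast
    rw [Nat.ceil_natCast]
  refine le_antisymm (iSup_le fun e' => ?_) ?_
  · rw [← key e']
    exact rootIdeal_ceil_mono f _ (Nat.le_add_left e' e)
  · rw [← key 0]
    exact le_iSup (fun e' : ℕ => rootIdeal (f ^ ⌈(r : ℝ) / (p : ℝ) ^ e * (p : ℝ) ^ e'⌉₊) (p ^ e')) _

theorem exists_rootIdeal_le_rootIdeal_pow_succ [Finite σ] {f : MvPolynomial σ k} (hf : f ≠ 0)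
    (r e : ℕ) : ∃ j, rootIdeal (f ^ r) (p ^ e) ≤
      rootIdeal (f ^ (r * p ^ j + 1)) (p ^ (e + j)) := by
  obtain ⟨j, hj⟩ := pow_unbounded_of_one_lt f.totalDegree (Fact.out : p.Prime).one_lt
  refine ⟨j, rootIdeal_le (mem_of_pow_mul_mem_bracketPow (p := p) hf hj ?_)⟩
  refine bracketPow_mul_le _ _ _ ?_
  rw [← pow_mul, ← pow_succ, ← pow_add]
  exact mem_bracketPow_rootIdeal _ _

/-- Test ideals are right continuous in the exponent. -/
theorem exists_gt_testIdeal_eq [Finite σ] {f : MvPolynomial σ k} (hf : f ≠ 0) (lam : ℝ) :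
    ∃ mu, lam < mu ∧ testIdeal f p mu = testIdeal f p lam := by
  have hp : (0 : ℝ) < p := Nat.cast_pos.2 (Fact.out : p.Prime).pos
  obtain ⟨e, he⟩ := monotone_stabilizes_iff_noetherian.2
    (inferInstanceAs (IsNoetherianRing (MvPolynomial σ k))) ⟨_, rootIdeal_ceil_mono (p := p) f lam⟩
  have hlam : testIdeal f p lam = rootIdeal (f ^ ⌈lam * (p : ℝ) ^ e⌉₊) (p ^ e) := by
    refine le_antisymm (iSup_le fun e' => ?_)
      (le_iSup (fun e : ℕ => rootIdeal (f ^ ⌈lam * (p : ℝ) ^ e⌉₊) (p ^ e)) e)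
    exact (rootIdeal_ceil_mono f lam (Nat.le_add_left e' e)).trans
      (he (e + e') (Nat.le_add_right _ _)).ge
  obtain ⟨j, hj⟩ := exists_rootIdeal_le_rootIdeal_pow_succ (p := p) hf ⌈lam * (p : ℝ) ^ e⌉₊ e
  have hlt : lam < ((⌈lam * (p : ℝ) ^ e⌉₊ * p ^ j + 1 : ℕ) : ℝ) / (p : ℝ) ^ (e + j) := by
    rw [lt_div_iff₀ (pow_pos hp _), pow_add, ← mul_assoc]
    push_cast
    exact lt_add_of_le_of_pos (by gcongr; exact Nat.le_ceil _) one_pos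
  refine ⟨_, hlt, le_antisymm (testIdeal_antitone f p hlt.le) ?_⟩
  rwa [testIdeal_div_pow, hlam]

theorem levelChain_eq_testIdeal (f : MvPolynomial σ k) (e : ℕ) :
    levelChain f p e = testIdeal f p (1 - ((p : ℝ) ^ e)⁻¹) := by
  have hp : (p : ℝ) ^ e ≠ 0 := pow_ne_zero e (Nat.cast_ne_zero.2 (Fact.out : p.Prime).ne_zero)
  have : (1 : ℝ) - ((p : ℝ) ^ e)⁻¹ = ((p ^ e - 1 : ℕ) : ℝ) / (p : ℝ) ^ e := by
    rw [Nat.cast_sub (Nat.one_le_pow _ _ (Fact.out : p.Prime).pos)]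
    push_cast
    field_simp
  rw [this, testIdeal_div_pow, levelChain]

end TestIdeal

/-- A right continuous antitone function taking different values at `a < b` has a last jump
in `(a, b]`. -/
theorem Antitone.exists_last_jump {α : Type*} [PartialOrder α] {T : ℝ → α} (hT : Antitone T)
    (hright : ∀ x, ∃ y, x < y ∧ T y = T x) {a b : ℝ} (hab : a < b) (hne : T a ≠ T b) :
    ∃ c, a < c ∧ c ≤ b ∧ T c = T b ∧ ∀ x < c, T x ≠ T c := by
  have hbelow : ∀ x ∈ {x | T x = T b}, a ≤ x := by
    intro x hx
    by_contra! hxa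
    exact hne (le_antisymm ((hT hxa.le).trans_eq hx) (hT hab.le))
  have hbdd : BddBelow {x | T x = T b} := ⟨a, hbelow⟩
  have hbmem : b ∈ {x | T x = T b} := rfl
  have hc : T (sInf {x | T x = T b}) = T b := by
    obtain ⟨y, hy, hTy⟩ := hright (sInf {x | T x = T b})
    obtain ⟨x, hx, hxy⟩ := exists_lt_of_csInf_lt ⟨b, hbmem⟩ hy
    exact (le_antisymm (hTy.ge.trans (hT hxy.le)) (hT (csInf_le hbdd hx))).trans hx
  refine ⟨_, lt_of_le_of_ne (le_csInf ⟨b, hbmem⟩ hbelow) ?_, csInf_le hbdd hbmem, hc, ?_⟩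
  · intro h
    exact hne (h ▸ hc)
  · intro x hx h
    exact notMem_of_lt_csInf hx hbdd (h.trans hc)

theorem levelChain_of_level_eq {R : Type*} [CommRing R] {f : R} {p t : ℕ}
    (h : level f p = t + 2) :
    (∀ e, t + 1 ≤ e → levelChain f p e = levelChain f p (t + 1)) ∧
      levelChain f p t ≠ levelChain f p (t + 1) := by
  have hinf : sInf {e : ℕ | ∀ e', e ≤ e' → levelChain f p e' = levelChain f p e} = t + 1 := by
    unfold level at h
    omega
  have hmem := Nat.sInf_mem (Nat.nonempty_of_sInf_eq_succ hinf)
  rw [hinf] at hmem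
  refine ⟨hmem, fun heq => ?_⟩
  refine Nat.notMem_of_lt_sInf (t.lt_succ_self.trans_eq hinf.symm) fun e he => ?_
  rcases he.eq_or_lt with rfl | he
  · rfl
  · rw [hmem e he, heq]

theorem ceil_one_sub_logb_eq {p : ℝ} (hp : 1 < p) {t : ℕ} {x : ℝ}
    (hl : (p ^ (t + 1))⁻¹ ≤ x) (hu : x < (p ^ t)⁻¹) :
    ⌈1 - Real.logb p x⌉ = (t : ℤ) + 2 := by
  have hp0 : 0 < p := one_pos.trans hp
  have hx : 0 < x := (inv_pos.2 (pow_pos hp0 _)).trans_le hl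
  have hl' : -((t : ℝ) + 1) ≤ Real.logb p x := by
    rw [Real.le_logb_iff_rpow_le hp hx, Real.rpow_neg hp0.le]
    exact_mod_cast hl
  have hu' : Real.logb p x < -(t : ℝ) := by
    rw [Real.logb_lt_iff_lt_rpow hp hx, Real.rpow_neg hp0.le]
    exact_mod_cast hu
  rw [Int.ceil_eq_iff]
  push_cast
  constructor <;> linarith

theorem level_and_F_jumping_exponents {k : Type*} [Field k] [PerfectField k]
    {p n : ℕ} [CharP k p] (hp : 2 < p)
    (f : MvPolynomial (Fin (n + 1)) k) (hf : f ≠ 0)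
    (m : ℕ) (hm : m = level f p) (hm2 : 2 ≤ m) :
    (∃ lam : ℝ, IsFJumpingExponent f p lam ∧
        1 - (p : ℝ) ^ (-((m : ℤ) - 2)) < lam ∧ lam ≤ 1 - (p : ℝ) ^ (-((m : ℤ) - 1))) ∧
    (∀ lam : ℝ, IsFJumpingExponent f p lam →
        ¬(1 - (p : ℝ) ^ (-((m : ℤ) - 1)) < lam ∧ lam < 1)) ∧
    (∃ e : ℝ, IsGreatest {lam : ℝ | IsFJumpingExponent f p lam ∧ 0 < lam ∧ lam < 1} e ∧
        1 - (p : ℝ) ^ (-((m : ℤ) - 2)) < e ∧ e ≤ 1 - (p : ℝ) ^ (-((m : ℤ) - 1)) ∧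
        (m : ℤ) = ⌈1 - Real.logb p (1 - e)⌉) := by
  obtain ⟨t, rfl⟩ := Nat.exists_eq_add_of_le' hm2
  have : NeZero p := ⟨by omega⟩
  have : Fact p.Prime := ⟨CharP.char_is_prime_of_pos k p |>.out⟩
  have hp1 : (1 : ℝ) < p := by exact_mod_cast (by omega : 1 < p)
  have hp0 : (0 : ℝ) < p := one_pos.trans hp1
  have ha : (p : ℝ) ^ (-(((t + 2 : ℕ) : ℤ) - 2)) = ((p : ℝ) ^ t)⁻¹ := by
    rw [← zpow_natCast, ← zpow_neg]
    congr 1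
    push_cast
    ring
  have hb : (p : ℝ) ^ (-(((t + 2 : ℕ) : ℤ) - 1)) = ((p : ℝ) ^ (t + 1))⁻¹ := by
    rw [← zpow_natCast, ← zpow_neg]
    congr 1
    push_cast
    ring
  rw [ha, hb]
  obtain ⟨hstable, hne⟩ := levelChain_of_level_eq hm.symm
  simp only [levelChain_eq_testIdeal] at hstable hne
  have hlt : ((p : ℝ) ^ (t + 1))⁻¹ < ((p : ℝ) ^ t)⁻¹ :=
    inv_strictAnti₀ (pow_pos hp0 t) (pow_lt_pow_right₀ hp1 t.lt_succ_self)
  have hle : ((p : ℝ) ^ t)⁻¹ ≤ 1 := inv_le_one_of_one_le₀ (one_le_pow₀ hp1.le)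
  have hpos : 0 < ((p : ℝ) ^ (t + 1))⁻¹ := inv_pos.2 (pow_pos hp0 _)
  have hT := testIdeal_antitone f p
  obtain ⟨c, hac, hcb, hTc, hjump⟩ := hT.exists_last_jump (exists_gt_testIdeal_eq hf)
    (by linarith : 1 - ((p : ℝ) ^ t)⁻¹ < 1 - ((p : ℝ) ^ (t + 1))⁻¹) hne
  have hc : IsFJumpingExponent f p c :=
    ⟨by linarith, fun x _ hx => hjump x hx⟩
  have hconst (x : ℝ) (hx : 1 - ((p : ℝ) ^ (t + 1))⁻¹ < x) (hx1 : x < 1) :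
      testIdeal f p (1 - ((p : ℝ) ^ (t + 1))⁻¹) = testIdeal f p x := by
    refine le_antisymm ?_ (hT hx.le)
    obtain ⟨e, he⟩ := exists_pow_lt_of_lt_one (sub_pos.2 hx1) (inv_lt_one_of_one_lt₀ hp1)
    rw [← hstable (t + 1 + e) (Nat.le_add_right _ _)]
    have : ((p : ℝ) ^ (t + 1 + e))⁻¹ ≤ (p : ℝ)⁻¹ ^ e := by
      rw [inv_pow]
      exact inv_anti₀ (pow_pos hp0 e) (pow_le_pow_right₀ hp1.le (Nat.le_add_left e _))
    exact hT (by linarith)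
  have hnone (x : ℝ) (hx : IsFJumpingExponent f p x) :
      ¬(1 - ((p : ℝ) ^ (t + 1))⁻¹ < x ∧ x < 1) := fun ⟨hbx, hx1⟩ =>
    hx.2 _ (by linarith) hbx (hconst x hbx hx1)
  refine ⟨⟨c, hc, hac, hcb⟩, hnone, c, ⟨⟨hc, hc.1, by linarith⟩, ?_⟩, hac, hcb, ?_⟩
  · rintro x ⟨hx, -, hx1⟩
    by_contra! hcx
    have hxb : x ≤ 1 - ((p : ℝ) ^ (t + 1))⁻¹ := not_lt.1 fun h => hnone x hx ⟨h, hx1⟩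
    exact hx.2 c hc.1 hcx (le_antisymm (hTc.trans_le (hT hxb)) (hT hcx.le))
  · rw [ceil_one_sub_logb_eq hp1 (t := t) (by linarith) (by linarith)]
    push_cast
    rfl
end

section
/- Let k be a perfect field of characteristic p, let n ≥ 2, and let f ∈ R = k[x₀,…,x_n] be a homogeneous polynomial of degree n+1 such that the projective hypersurface X = Proj(R/fR) is smooth, i.e. the radical of the ideal of R generated by f and its partial derivatives ∂f/∂x₀, …, ∂f/∂x_n equals the irrelevant maximal ideal (x₀,…,x_n) (so X is a Calabi–Yau hypersurface). Suppose p > 2 and p > n² − n − 1. Then (f^{p−1})^{[1/p]} = (f^{p^e−1})^{[1/p^e]} for every integer e ≥ 1; equivalently, the level of f is at most 2 (this is the statement that the Hartshorne–Speiser–Lyubeznik number of the top local cohomology of R/fR with its Frobenius action is 1). -/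
open MvPolynomial

section Parameters

attribute [local instance] MvPolynomial.gradedAlgebra

variable {σ K : Type*} [Field K]

theorem homogeneousComponent_mul_of_isHomogeneous {b w : MvPolynomial σ K} {β : ℕ}
    (hb : b.IsHomogeneous β) (D : ℕ) :
    homogeneousComponent (β + D) (b * w) = b * homogeneousComponent D w := by
  have h := DirectSum.coe_decompose_mul_of_left_mem_of_le (homogeneousSubmodule σ K)
    (b := w) (n := β + D) hb (Nat.le_add_right _ _)
  rw [Nat.add_sub_cancel_left] at h
  rw [← decomposition.decompose'_apply, ← decomposition.decompose'_apply]
  exact h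

theorem homogeneousComponent_mul_of_lt {b w : MvPolynomial σ K} {β D : ℕ}
    (hb : b.IsHomogeneous β) (hD : D < β) :
    homogeneousComponent D (b * w) = 0 := by
  rw [← decomposition.decompose'_apply]
  exact DirectSum.coe_decompose_mul_of_left_mem_of_not_le (homogeneousSubmodule σ K)
    (b := w) (n := D) hb (Nat.not_le.mpr hD)

theorem isHomogeneous_span_image {a : σ → MvPolynomial σ K} {d : σ → ℕ}
    (ha : ∀ i, (a i).IsHomogeneous (d i)) (s : Set σ) :
    (Ideal.span (a '' s)).IsHomogeneous (homogeneousSubmodule σ K) :=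
  Ideal.homogeneous_span _ _ (by rintro _ ⟨i, -, rfl⟩; exact ⟨d i, ha i⟩)

theorem mem_idealOfVars_pow_of_isHomogeneous {u : MvPolynomial σ K} {D N : ℕ}
    (hu : u.IsHomogeneous D) (hD : N ≤ D) : u ∈ idealOfVars σ K ^ N := by
  rw [mem_pow_idealOfVars_iff']
  exact fun x hx => hu.coeff_eq_zero (by lia)

theorem mem_idealOfVars_of_isHomogeneous {u : MvPolynomial σ K} {D : ℕ}
    (hu : u.IsHomogeneous D) (hD : 0 < D) : u ∈ idealOfVars σ K := by
  rw [← pow_one (idealOfVars σ K)]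
  exact mem_idealOfVars_pow_of_isHomogeneous hu hD

theorem homogeneousComponent_eq_zero_of_mem_pow {u : MvPolynomial σ K} {D N : ℕ}
    (hu : u ∈ idealOfVars σ K ^ N) (hD : D < N) : homogeneousComponent D u = 0 := by
  rw [mem_pow_idealOfVars_iff'] at hu
  ext x
  rw [coeff_homogeneousComponent]
  split_ifs with h
  · exact hu x (by lia)
  · rfl

/-- A homogeneous ideal is closed in the topology defined by the ideal of variables. -/
theorem mem_of_forall_mem_sup_pow {I : Ideal (MvPolynomial σ K)}
    (hI : I.IsHomogeneous (homogeneousSubmodule σ K)) {u : MvPolynomial σ K}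
    (hu : ∀ N, u ∈ I ⊔ idealOfVars σ K ^ N) : u ∈ I := by
  rw [mem_iff_homogeneousComponent_mem hI]
  intro D
  obtain ⟨v, hv, w, hw, rfl⟩ := Submodule.mem_sup.mp (hu (D + 1))
  rw [map_add, homogeneousComponent_eq_zero_of_mem_pow hw D.lt_succ_self, add_zero]
  exact homogeneousComponent_mem_of_mem hI hv D

theorem mem_span_image_insert_iff {R ι : Type*} [CommRing R] {a : ι → R} {r : ι} {s : Set ι}
    {u : R} :
    u ∈ Ideal.span (a '' insert r s) ↔ ∃ v, u - a r * v ∈ Ideal.span (a '' s) := by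
  rw [Set.image_insert_eq, Ideal.mem_span_insert]
  constructor
  · rintro ⟨v, z, hz, rfl⟩
    exact ⟨v, by rwa [mul_comm, add_sub_cancel_left]⟩
  · rintro ⟨v, hv⟩
    exact ⟨v, _, hv, by ring⟩

theorem mem_span_range_iff {R ι : Type*} [CommRing R] {a : ι → R} (r : ι) {u : R} :
    u ∈ Ideal.span (Set.range a) ↔ ∃ v, u - a r * v ∈ Ideal.span (a '' {r}ᶜ) := by
  rw [← mem_span_image_insert_iff, ← Set.image_univ]
  congr!
  ext i
  simp [em]

theorem image_eq_of_notMem {R ι : Type*} {a a' : ι → R} {r : ι} (h : ∀ i, i ≠ r → a' i = a i)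
    {s : Set ι} (hs : r ∉ s) : a' '' s = a '' s :=
  Set.image_congr fun i hi => h i (by rintro rfl; exact hs hi)

theorem span_range_update {R ι : Type*} [CommRing R] [DecidableEq ι] (a : ι → R) (r : ι) (b : R) :
    Ideal.span (Set.range (Function.update a r b)) = Ideal.span (insert b (a '' {r}ᶜ)) := by
  ext u
  rw [mem_span_range_iff r, Function.update_self, image_eq_of_notMem (a := a)
    (fun i hi => Function.update_of_ne hi _ _) (by simp), Ideal.mem_span_insert]
  constructor
  · rintro ⟨v, hv⟩
    exact ⟨v, _, hv, by ring⟩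
  · rintro ⟨v, z, hz, rfl⟩
    exact ⟨v, by rwa [mul_comm, add_sub_cancel_left]⟩

theorem idealOfVars_eq_ker : idealOfVars σ K = RingHom.ker constantCoeff := by
  ext u
  rw [← pow_one (idealOfVars σ K), mem_pow_idealOfVars_iff', RingHom.mem_ker, constantCoeff_eq]
  simp [Finsupp.degree_eq_zero_iff]

instance isMaximal_idealOfVars : (idealOfVars σ K).IsMaximal := by
  rw [idealOfVars_eq_ker]
  exact RingHom.ker_isMaximal_of_surjective _ fun c => ⟨C c, constantCoeff_C σ c⟩

theorem le_idealOfVars_of_isHomogeneous {I : Ideal (MvPolynomial σ K)}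
    (hI : I.IsHomogeneous (homogeneousSubmodule σ K)) (htop : I ≠ ⊤) : I ≤ idealOfVars σ K := by
  intro u hu
  rw [idealOfVars_eq_ker, RingHom.mem_ker, constantCoeff_eq]
  by_contra hne
  have h := homogeneousComponent_mem_of_mem hI hu 0
  rw [homogeneousComponent_zero] at h
  exact htop (Ideal.eq_top_of_isUnit_mem _ h (IsUnit.map C (Ne.isUnit hne)))

theorem isHomogeneous_linearCombination {ι : Type*} [Fintype ι] {v : ι → MvPolynomial σ K} {δ : ℕ}
    (hv : ∀ i, (v i).IsHomogeneous δ) (w : ι → K) :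
    (Fintype.linearCombination K v w).IsHomogeneous δ := by
  rw [Fintype.linearCombination_apply]
  refine IsHomogeneous.sum _ _ _ fun i _ => ?_
  rw [smul_eq_C_mul]
  exact (hv i).C_mul _

theorem span_range_linearCombination {ι : Type*} [Fintype ι] (v : ι → MvPolynomial σ K) :
    Ideal.span (Set.range (Fintype.linearCombination K v)) = Ideal.span (Set.range v) := by
  classical
  refine le_antisymm ?_ (Ideal.span_mono ?_)
  · rw [Ideal.span_le]
    rintro _ ⟨w, rfl⟩
    rw [Fintype.linearCombination_apply]
    exact sum_mem fun i _ => Submodule.smul_of_tower_mem _ _ (Ideal.subset_span ⟨i, rfl⟩)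
  · rintro _ ⟨i, rfl⟩
    exact ⟨Pi.single i 1, by simp⟩

/-- A family of forms of positive degree, as many as there are variables, whose only common
zero is the origin. -/
structure IsHomogeneousSOP (a : σ → MvPolynomial σ K) (d : σ → ℕ) : Prop where
  isHomogeneous : ∀ i, (a i).IsHomogeneous (d i)
  pos : ∀ i, 0 < d i
  le_radical : idealOfVars σ K ≤ (Ideal.span (Set.range a)).radical

/-- The family is a regular sequence in every order, and every form of degree exceeding
`∑ i, (d i - 1)` lies in the ideal it generates. -/
structure IsRegularWithTopDegree [Fintype σ] (a : σ → MvPolynomial σ K) (d : σ → ℕ) : Prop where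
  regular : ∀ (s : Set σ) (i : σ), i ∉ s → ∀ u,
    a i * u ∈ Ideal.span (a '' s) → u ∈ Ideal.span (a '' s)
  mem_of_degree : ∀ (D : ℕ) (u : MvPolynomial σ K), u.IsHomogeneous D →
    ∑ i, d i < D + Fintype.card σ → u ∈ Ideal.span (Set.range a)

theorem isHomogeneousSOP_X : IsHomogeneousSOP (X : σ → MvPolynomial σ K) 1 :=
  ⟨fun i => isHomogeneous_X K i, fun _ => one_pos, Ideal.le_radical⟩

namespace IsHomogeneousSOP

variable {a a' : σ → MvPolynomial σ K} {d d' : σ → ℕ} {r : σ}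

theorem mem_idealOfVars (ha : IsHomogeneousSOP a d) (i : σ) : a i ∈ idealOfVars σ K :=
  mem_idealOfVars_of_isHomogeneous (ha.isHomogeneous i) (ha.pos i)

variable [Fintype σ]

theorem exists_pow_le (ha : IsHomogeneousSOP a d) :
    ∃ M, idealOfVars σ K ^ M ≤ Ideal.span (Set.range a) :=
  Ideal.exists_pow_le_of_le_radical_of_fg ha.le_radical (idealOfVars_fg σ K)

/-- Replacing one member of a permutable regular family keeps the new member regular. -/
theorem regular_of_replace (ha : IsHomogeneousSOP a d) (hreg : IsRegularWithTopDegree a d)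
    (ha' : IsHomogeneousSOP a' d') (h : ∀ i, i ≠ r → a' i = a i) (t : Finset σ) :
    ∀ u, a' r * u ∈ Ideal.span (a '' (insert r (t : Set σ))ᶜ) →
      u ∈ Ideal.span (a '' (insert r (t : Set σ))ᶜ) := by
  classical
  induction t using Finset.induction with
  | empty =>
    intro u hu
    simp only [Finset.coe_empty, insert_empty_eq] at hu ⊢
    obtain ⟨N, hN⟩ := ha'.le_radical (ha.mem_idealOfVars r)
    obtain ⟨v, hv⟩ := (mem_span_range_iff r).mp hN
    rw [image_eq_of_notMem h (by simp)] at hv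
    have hpow : a r ^ N * u ∈ Ideal.span (a '' {r}ᶜ) := by
      have := add_mem (Ideal.mul_mem_left _ u hv) (Ideal.mul_mem_left _ v hu)
      convert this using 1
      ring
    clear hN hv
    induction N with
    | zero => simpa using hpow
    | succ N ih =>
      refine ih (hreg.regular _ r (by simp) _ ?_)
      rwa [← mul_assoc, ← pow_succ']
  | insert c t _ ih =>
    by_cases hc : c ∈ insert r (t : Set σ)
    · rw [Finset.coe_insert, Set.insert_comm, Set.insert_eq_of_mem hc]
      exact ih
    set s : Set σ := (insert r ((insert c t : Finset σ) : Set σ))ᶜ with hs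
    have hcs : c ∉ s := by simp [hs]
    have hins : (insert r (t : Set σ))ᶜ = insert c s := by
      ext i
      by_cases hi : i = c
      · subst hi; simpa using hc
      · simp [hs, hi]
    rw [hins] at ih
    suffices key : ∀ N, ∀ u, a' r * u ∈ Ideal.span (a '' s) →
        u ∈ Ideal.span (a '' s) ⊔ idealOfVars σ K ^ N from fun u hu =>
      mem_of_forall_mem_sup_pow (isHomogeneous_span_image ha.isHomogeneous s)
        fun N => key N u hu
    intro N
    induction N with
    | zero => intro u _; simp
    | succ N ihN =>
      intro u hu
      obtain ⟨v, hv⟩ := mem_span_image_insert_iff.mp <| ih u <|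
        Ideal.span_mono (Set.image_mono (Set.subset_insert c s)) hu
      have hv' : a' r * v ∈ Ideal.span (a '' s) := by
        refine hreg.regular s c hcs _ ?_
        have := sub_mem hu (Ideal.mul_mem_left _ (a' r) hv)
        convert this using 1
        ring
      obtain ⟨y, hy, z, hz, rfl⟩ := Submodule.mem_sup.mp (ihN v hv')
      rw [show u = (u - a c * (y + z) + a c * y) + a c * z by ring]
      refine Submodule.add_mem_sup (add_mem hv (Ideal.mul_mem_left _ _ hy)) ?_
      rw [pow_succ']
      exact Ideal.mul_mem_mul (ha.mem_idealOfVars c) hz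

/-- The exchange step: regularity and the top degree pass from one system of parameters to another
one that differs in a single member. -/
theorem isRegularWithTopDegree_of_replace (ha : IsHomogeneousSOP a d)
    (hreg : IsRegularWithTopDegree a d) (ha' : IsHomogeneousSOP a' d')
    (h : ∀ i, i ≠ r → a' i = a i) (hd : ∀ i, i ≠ r → d' i = d i) :
    IsRegularWithTopDegree a' d' := by
  classical
  have hnew : ∀ s : Set σ, r ∉ s → ∀ u, a' r * u ∈ Ideal.span (a '' s) →
      u ∈ Ideal.span (a '' s) := by
    intro s hs
    have := regular_of_replace ha hreg ha' h (sᶜ).toFinset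
    rwa [Set.coe_toFinset, Set.insert_eq_of_mem (by simpa using hs), compl_compl] at this
  constructor
  · intro s i hi u hu
    by_cases hr : r ∈ s
    · have hir : i ≠ r := by rintro rfl; exact hi hr
      obtain ⟨s, rfl, hrs⟩ : ∃ s', s = insert r s' ∧ r ∉ s' := ⟨s \ {r}, by simp [hr], by simp⟩
      have his : i ∉ s := fun h => hi (Set.mem_insert_of_mem _ h)
      rw [mem_span_image_insert_iff, image_eq_of_notMem h hrs] at hu ⊢
      obtain ⟨v, hv⟩ := hu
      rw [h i hir] at hv
      have hv' : v ∈ Ideal.span (a '' insert i s) := by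
        refine hnew _ (by simp [hir.symm, hrs]) v ?_
        rw [mem_span_image_insert_iff]
        exact ⟨u, by rw [← neg_sub]; exact neg_mem hv⟩
      obtain ⟨w, hw⟩ := mem_span_image_insert_iff.mp hv'
      refine ⟨w, hreg.regular s i his _ ?_⟩
      have := add_mem hv (Ideal.mul_mem_left _ (a' r) hw)
      convert this using 1
      ring
    · rw [image_eq_of_notMem h hr] at hu ⊢
      by_cases hir : i = r
      · subst hir; exact hnew s hr u hu
      · rw [h i hir] at hu
        exact hreg.regular s i hi u hu
  · obtain ⟨M, hM⟩ := ha'.exists_pow_le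
    have hsum : ∑ i, d' i + d r = ∑ i, d i + d' r := by
      rw [← Finset.add_sum_erase _ d (Finset.mem_univ r),
        ← Finset.add_sum_erase _ d' (Finset.mem_univ r),
        Finset.sum_congr rfl fun i hi => hd i (Finset.ne_of_mem_erase hi)]
      ring
    suffices key : ∀ k D : ℕ, M ≤ D + k → ∀ u : MvPolynomial σ K, u.IsHomogeneous D →
        ∑ i, d' i < D + Fintype.card σ → u ∈ Ideal.span (Set.range a') from
      fun D u => key M D (by lia) u
    intro k
    induction k with
    | zero => exact fun D hD u hu _ => hM (mem_idealOfVars_pow_of_isHomogeneous hu hD)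
    | succ k ih =>
      intro D hD u hu hlt
      have hpos := ha.pos r
      have hau : (a r * u).IsHomogeneous (d r + D) := (ha.isHomogeneous r).mul hu
      obtain ⟨w, hw⟩ := (mem_span_range_iff r).mp
        (ih (d r + D) (by lia) (a r * u) hau (by lia))
      rw [image_eq_of_notMem h (by simp)] at hw
      have hw := homogeneousComponent_mem_of_mem (isHomogeneous_span_image ha.isHomogeneous _) hw
        (d r + D)
      rw [map_sub, homogeneousComponent_eq_self hau] at hw
      rw [mem_span_range_iff r, image_eq_of_notMem h (by simp)]
      by_cases hle : d' r ≤ d r + D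
      · obtain ⟨E, hE⟩ := Nat.exists_eq_add_of_le hle
        rw [hE, homogeneousComponent_mul_of_isHomogeneous (ha'.isHomogeneous r)] at hw
        obtain ⟨v, hv⟩ := (mem_span_range_iff r).mp <| hreg.mem_of_degree E _
          (homogeneousComponent_isHomogeneous E w) (by lia)
        refine ⟨v, hreg.regular _ r (by simp) _ ?_⟩
        have := add_mem hw (Ideal.mul_mem_left _ (a' r) hv)
        convert this using 1
        ring
      · rw [homogeneousComponent_mul_of_lt (ha'.isHomogeneous r) (by lia), sub_zero] at hw
        exact ⟨0, by simpa using hreg.regular _ r (by simp) _ hw⟩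

end IsHomogeneousSOP

variable [Fintype σ]

theorem isRegularWithTopDegree_X : IsRegularWithTopDegree (X : σ → MvPolynomial σ K) 1 := by
  refine ⟨fun s i hi u hu => ?_, fun D u hu hD => ?_⟩
  · rw [mem_ideal_span_X_image] at hu ⊢
    intro m hm
    obtain ⟨j, hj, hne⟩ := hu (Finsupp.single i 1 + m) (by
      rw [mem_support_iff, coeff_X_mul]; exact mem_support_iff.mp hm)
    refine ⟨j, hj, ?_⟩
    have hij : i ≠ j := by rintro rfl; exact hi hj
    simpa [Finsupp.single_apply, hij] using hne
  · simp only [Pi.one_apply, Finset.sum_const, Finset.card_univ, smul_eq_mul, mul_one] at hD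
    exact mem_idealOfVars_of_isHomogeneous hu (by lia)


namespace IsHomogeneousSOP

variable {a a' : σ → MvPolynomial σ K} {d d' : σ → ℕ} {r : σ}

/-- A prime ideal that contains all but one member of a system of parameters, contained in but
different from the ideal of variables, is minimal over those members. -/
theorem mem_minimalPrimes (ha : IsHomogeneousSOP a d) {Q : Ideal (MvPolynomial σ K)}
    (hQ : Q.IsPrime) (hlt : Q < idealOfVars σ K) (haQ : a '' {r}ᶜ ⊆ Q) :
    Q ∈ (Ideal.span (a '' {r}ᶜ)).minimalPrimes := by
  classical
  have hspan : Ideal.span (insert (a r) (a '' {r}ᶜ)) = Ideal.span (Set.range a) := by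
    rw [← span_range_update, Function.update_eq_self]
  refine Ideal.mem_minimalPrimes_span_of_mem_minimalPrimes_span_insert hlt (a r) (a '' {r}ᶜ)
    ⟨⟨isMaximal_idealOfVars.isPrime, ?_⟩, fun P hP _ => ?_⟩ _ haQ ?_
  · rw [hspan, Ideal.span_le]
    rintro _ ⟨i, rfl⟩
    exact ha.mem_idealOfVars i
  · rw [hspan] at hP
    exact ha.le_radical.trans (hP.1.radical_le_iff.mpr hP.2)
  · exact (Set.subset_insert _ _).trans (Ideal.subset_span.trans Ideal.le_radical)

/-- A member of a system of parameters can be replaced by a form outside finitely many proper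
subspaces of a linear system that has no common zero with the other members. -/
theorem exists_finite_replace [DecidableEq σ] {W : Type*} [AddCommGroup W] [Module K W]
    (ha : IsHomogeneousSOP a d) (r : σ) (φ : W →ₗ[K] MvPolynomial σ K) {δ : ℕ} (hδ : 0 < δ)
    (hφ : ∀ w, (φ w).IsHomogeneous δ)
    (hrad : idealOfVars σ K ≤ (Ideal.span (a '' {r}ᶜ) ⊔ Ideal.span (Set.range φ)).radical) :
    ∃ S : Set (Submodule K W), S.Finite ∧ ⊤ ∉ S ∧ ∀ w, (∀ U ∈ S, w ∉ U) →
      IsHomogeneousSOP (Function.update a r (φ w)) (Function.update d r δ) := by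
  refine ⟨(fun P : Ideal (MvPolynomial σ K) => (P.restrictScalars K).comap φ) ''
    {P ∈ (Ideal.span (a '' {r}ᶜ)).minimalPrimes | ¬ idealOfVars σ K ≤ P},
    ((Ideal.finite_minimalPrimes_of_isNoetherianRing _ _).subset (Set.sep_subset _ _)).image _,
    ?_, fun w hw => ?_⟩
  · rintro ⟨P, ⟨hP, hmP⟩, htop⟩
    refine hmP (hrad.trans (hP.1.1.radical_le_iff.mpr (sup_le hP.1.2 ?_)))
    rw [Ideal.span_le]
    rintro _ ⟨w, rfl⟩
    exact htop.ge (Submodule.mem_top (x := w))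
  have hom : ∀ i, (Function.update a r (φ w) i).IsHomogeneous (Function.update d r δ i) := by
    intro i
    by_cases hi : i = r
    · subst hi; simpa using hφ w
    · simpa [hi] using ha.isHomogeneous i
  refine ⟨hom, fun i => ?_, ?_⟩
  · by_cases hi : i = r
    · subst hi; simpa using hδ
    · simpa [hi] using ha.pos i
  rw [Ideal.radical_eq_sInf]
  refine le_sInf fun P ⟨hle, hP⟩ => ?_
  set Q := (P.homogeneousCore (homogeneousSubmodule σ K)).toIdeal with hQ
  have hQP : Q ≤ P := Ideal.toIdeal_homogeneousCore_le _ P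
  have hQprime : Q.IsPrime := hP.homogeneousCore
  have hmem : ∀ i, Function.update a r (φ w) i ∈ Q := fun i =>
    Ideal.mem_homogeneousCore_of_homogeneous_of_mem ⟨_, hom i⟩ (hle (Ideal.subset_span ⟨i, rfl⟩))
  have hQm : Q ≤ idealOfVars σ K :=
    le_idealOfVars_of_isHomogeneous (HomogeneousIdeal.isHomogeneous _) hQprime.ne_top
  have haQ : a '' {r}ᶜ ⊆ Q := by
    rintro _ ⟨i, hi, rfl⟩
    simpa [show i ≠ r from hi] using hmem i
  by_contra hcon
  have hmQ : ¬ idealOfVars σ K ≤ Q := fun h => hcon (h.trans hQP)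
  refine hw _ ⟨Q, ⟨ha.mem_minimalPrimes hQprime (lt_of_le_not_ge hQm hmQ) haQ, hmQ⟩, rfl⟩ ?_
  simpa using hmem r

variable [Infinite K]

theorem exists_notMem_of_finite {W : Type*} [AddCommGroup W] [Module K W]
    {S : Set (Submodule K W)} (hS : S.Finite) (htop : ⊤ ∉ S) : ∃ w, ∀ U ∈ S, w ∉ U := by
  have := hS.to_subtype
  obtain ⟨w, hw⟩ := Submodule.exists_forall_notMem_of_forall_ne_top
    (fun U : S => (U : Submodule K W))
    (fun U h => htop (h ▸ U.2))
  exact ⟨w, fun U hU => hw ⟨U, hU⟩⟩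

theorem isRegularWithTopDegree_of_eqOn_compl (s : Finset σ) :
    ∀ {a a' : σ → MvPolynomial σ K} {d d' : σ → ℕ}, IsHomogeneousSOP a d →
      IsHomogeneousSOP a' d' → (∀ i ∉ s, a' i = a i ∧ d' i = d i) →
      IsRegularWithTopDegree a d → IsRegularWithTopDegree a' d' := by
  classical
  induction s using Finset.induction with
  | empty =>
    intro a a' d d' _ _ h hreg
    obtain rfl : a' = a := funext fun i => (h i (by simp)).1
    obtain rfl : d' = d := funext fun i => (h i (by simp)).2
    exact hreg
  | insert r s hr ih =>
    intro a a' d d' ha ha' h hreg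
    let φ : (σ → K) →ₗ[K] MvPolynomial σ K := Fintype.linearCombination K X
    have hφ := isHomogeneous_linearCombination (isHomogeneous_X K (σ := σ))
    have hX : idealOfVars σ K ≤ Ideal.span (Set.range φ) := (span_range_linearCombination X).ge
    obtain ⟨S, hS, htop, hS'⟩ := ha.exists_finite_replace r φ one_pos hφ
      (hX.trans (le_sup_right.trans Ideal.le_radical))
    obtain ⟨T, hT, htop', hT'⟩ := ha'.exists_finite_replace r φ one_pos hφ
      (hX.trans (le_sup_right.trans Ideal.le_radical))
    obtain ⟨w, hw⟩ := exists_notMem_of_finite (hS.union hT) (by simp [htop, htop'])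
    have hb := hS' w fun U hU => hw U (Or.inl hU)
    have hb' := hT' w fun U hU => hw U (Or.inr hU)
    have hregb := ha.isRegularWithTopDegree_of_replace (r := r) hreg hb
      (fun i hi => by simp [hi]) (fun i hi => by simp [hi])
    refine hb'.isRegularWithTopDegree_of_replace (r := r) (ih hb hb' (fun i hi => ?_) hregb) ha'
      (fun i hi => by simp [hi]) (fun i hi => by simp [hi])
    by_cases hir : i = r
    · subst hir; simp
    · simpa [hir] using h i (by simp [hir, hi])

/-- Macaulay's theorem for homogeneous systems of parameters of a polynomial ring. -/
theorem isRegularWithTopDegree (ha : IsHomogeneousSOP a d) : IsRegularWithTopDegree a d :=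
  isRegularWithTopDegree_of_eqOn_compl Finset.univ isHomogeneousSOP_X ha (by simp)
    isRegularWithTopDegree_X

end IsHomogeneousSOP

/-- Every form of large enough degree lies in the Jacobian ideal of a smooth hypersurface. -/
theorem mem_jacobian_of_degree [Infinite K] [Nonempty σ] {N : ℕ} (hN : 0 < N)
    {f : MvPolynomial σ K} (hf : f.IsHomogeneous (N + 1))
    (hrad : idealOfVars σ K ≤ (Ideal.span ({f} ∪ Set.range fun i => pderiv i f)).radical)
    {D : ℕ} {u : MvPolynomial σ K} (hu : u.IsHomogeneous D)
    (hD : N * Fintype.card σ + 1 < D + Fintype.card σ) :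
    u ∈ Ideal.span ({f} ∪ Set.range fun i => pderiv i f) := by
  classical
  set J := Ideal.span ({f} ∪ Set.range fun i => pderiv i f) with hJ
  have hfJ : f ∈ J := Ideal.subset_span (Or.inl rfl)
  have hdJ : ∀ i, pderiv i f ∈ J := fun i => Ideal.subset_span (Or.inr ⟨i, rfl⟩)
  have hd : ∀ i, (pderiv i f).IsHomogeneous N := fun i => hf.pderiv
  obtain ⟨j⟩ := ‹Nonempty σ›
  obtain ⟨g, hgJ, hJg, hg⟩ : ∃ g ∈ J,
      J ≤ Ideal.span {g} ⊔ Ideal.span (Set.range fun i => pderiv i f) ∧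
      IsHomogeneousSOP (Function.update X j g) (Function.update (1 : σ → ℕ) j (N + 1)) := by
    let v : Option (σ × σ) → MvPolynomial σ K :=
      fun o => o.elim f fun ij => X ij.1 * pderiv ij.2 f
    have hv : ∀ o, (v o).IsHomogeneous (N + 1) := by
      rintro (_ | ⟨i, l⟩)
      · exact hf
      · rw [add_comm]
        exact (isHomogeneous_X K i).mul (hd l)
    have hvrad : idealOfVars σ K ≤ (Ideal.span (Set.range v)).radical := by
      rw [Ideal.radical_eq_sInf]
      refine le_sInf fun P ⟨hle, hP⟩ => ?_
      by_cases hall : ∀ l, pderiv l f ∈ P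
      · refine hrad.trans (hP.radical_le_iff.mpr ?_)
        rw [hJ, Ideal.span_le, Set.union_subset_iff, Set.singleton_subset_iff]
        refine ⟨hle (Ideal.subset_span ⟨none, rfl⟩), ?_⟩
        rintro _ ⟨l, rfl⟩
        exact hall l
      · push Not at hall
        obtain ⟨l, hl⟩ := hall
        rw [Ideal.span_le]
        rintro _ ⟨i, rfl⟩
        exact (hP.mem_or_mem (hle (Ideal.subset_span ⟨some (i, l), rfl⟩))).resolve_right hl
    obtain ⟨S, hS, htop, hS'⟩ := isHomogeneousSOP_X.exists_finite_replace j
      (Fintype.linearCombination K v) N.succ_pos (isHomogeneous_linearCombination hv)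
      (hvrad.trans (Ideal.radical_mono (by rw [span_range_linearCombination]; exact le_sup_right)))
    obtain ⟨w, hw⟩ := IsHomogeneousSOP.exists_notMem_of_finite
      (S := insert (LinearMap.ker (LinearMap.proj none : (Option (σ × σ) → K) →ₗ[K] K)) S)
      (hS.insert _) (by
        rintro (h | h)
        · have : (Pi.single none 1 : Option (σ × σ) → K) ∈
            LinearMap.ker (LinearMap.proj none : (Option (σ × σ) → K) →ₗ[K] K) := h ▸ trivial
          simp at this
        · exact htop h)
    have hw0 : w none ≠ 0 := by simpa using hw _ (Set.mem_insert _ _)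
    have hsum : Fintype.linearCombination K v w =
        C (w none) * f + ∑ ij : σ × σ, C (w (some ij)) * (X ij.1 * pderiv ij.2 f) := by
      simp [Fintype.linearCombination_apply, Fintype.sum_option, smul_eq_C_mul, v]
    refine ⟨_, ?_, ?_, hS' w fun U hU => hw U (Set.mem_insert_of_mem _ hU)⟩
    · rw [hsum]
      exact add_mem (Ideal.mul_mem_left _ _ hfJ) (sum_mem fun ij _ =>
        Ideal.mul_mem_left _ _ (Ideal.mul_mem_left _ _ (hdJ _)))
    · rw [hJ, Ideal.span_union]
      refine sup_le ?_ le_sup_right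
      rw [Ideal.span_singleton_le_iff_mem]
      have : f = C (w none)⁻¹ * Fintype.linearCombination K v w -
          C (w none)⁻¹ * ∑ ij : σ × σ, C (w (some ij)) * (X ij.1 * pderiv ij.2 f) := by
        rw [hsum, mul_add, add_sub_cancel_right, ← mul_assoc, ← C_mul, inv_mul_cancel₀ hw0, C_1,
          one_mul]
      refine (congrArg (· ∈ _) this).mpr ?_
      refine sub_mem (Ideal.mul_mem_left _ _ (Submodule.mem_sup_left
        (Ideal.mem_span_singleton_self _))) (Ideal.mul_mem_left _ _ (Submodule.mem_sup_right
          (sum_mem fun ij _ => Ideal.mul_mem_left _ _ (Ideal.mul_mem_left _ _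
            (Ideal.subset_span ⟨_, rfl⟩)))))
  obtain ⟨a, d, ha, haj, hdj, has⟩ : ∃ a d, IsHomogeneousSOP (K := K) (σ := σ) a d ∧ a j = g ∧
      d j = N + 1 ∧ ∀ i ∈ Finset.univ.erase j, a i ∈ J ∧ d i = N := by
    have hj : j ∉ Finset.univ.erase j := by simp
    generalize Finset.univ.erase j = s at hj
    induction s using Finset.induction with
    | empty => exact ⟨_, _, hg, by simp, by simp, by simp⟩
    | insert r s hrs ih =>
      rw [Finset.mem_insert, not_or] at hj
      obtain ⟨a, d, ha, haj, hdj, has⟩ := ih hj.2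
      obtain ⟨S, hS, htop, hS'⟩ := ha.exists_finite_replace r
        (Fintype.linearCombination K fun i => pderiv i f) hN (isHomogeneous_linearCombination hd)
        (hrad.trans (Ideal.radical_mono (by
          rw [span_range_linearCombination]
          refine hJg.trans (sup_le_sup_right (Ideal.span_mono ?_) _)
          rw [Set.singleton_subset_iff]
          exact ⟨j, hj.1, haj⟩)))
      obtain ⟨w, hw⟩ := IsHomogeneousSOP.exists_notMem_of_finite hS htop
      refine ⟨_, _, hS' w hw, by simp [hj.1, haj], by simp [hj.1, hdj], fun i hi => ?_⟩
      by_cases hir : i = r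
      · subst hir
        simp only [Function.update_self, and_true]
        rw [Fintype.linearCombination_apply]
        exact sum_mem fun l _ => Submodule.smul_of_tower_mem _ _ (hdJ l)
      · simpa [hir] using has i ((Finset.mem_insert.mp hi).resolve_left hir)
  have hsum : ∑ i, d i = N * Fintype.card σ + 1 := by
    rw [← Finset.add_sum_erase _ d (Finset.mem_univ j), hdj,
      Finset.sum_congr rfl fun i hi => (has i hi).2, Finset.sum_const,
      Finset.card_erase_of_mem (Finset.mem_univ j), Finset.card_univ, smul_eq_mul]
    obtain ⟨c, hc⟩ := Nat.exists_eq_succ_of_ne_zero (Fintype.card_ne_zero (α := σ))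
    rw [hc]
    simp only [Nat.succ_eq_add_one, Nat.add_sub_cancel]
    ring
  refine Ideal.span_le.mpr ?_ (ha.isRegularWithTopDegree.mem_of_degree D u hu (by lia))
  rintro _ ⟨i, rfl⟩
  by_cases hij : i = j
  · subst hij; exact haj ▸ hgJ
  · exact (has i (by simp [hij])).1

end Parameters

section VarPow

variable {σ K : Type*} [Field K]

theorem degree_eq_of_isHomogeneous {u : MvPolynomial σ K} {D : ℕ} (hu : u.IsHomogeneous D)
    {γ : σ →₀ ℕ} (hγ : coeff γ u ≠ 0) : γ.degree = D := by
  rw [Finsupp.degree_eq_weight_one]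
  exact hu hγ

theorem pow_succ_sub_one {p : ℕ} (hp : 0 < p) (e : ℕ) :
    p ^ (e + 1) - 1 = p * (p ^ e - 1) + (p - 1) := by
  rw [Nat.mul_sub, mul_one, ← pow_succ']
  have : p ≤ p ^ (e + 1) := Nat.le_self_pow e.succ_ne_zero p
  omega

/-- The exponent all of whose entries are `m`. -/
noncomputable def constExponent (σ : Type*) [Fintype σ] (m : ℕ) : σ →₀ ℕ :=
  Finsupp.equivFunOnFinite.symm fun _ => m

theorem constExponent_apply [Fintype σ] (m : ℕ) (i : σ) : constExponent σ m i = m := rfl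

theorem degree_constExponent [Fintype σ] (m : ℕ) :
    (constExponent σ m).degree = Fintype.card σ * m := by
  simp [Finsupp.degree_eq_sum, constExponent_apply]

/-- The ideal generated by the `Q`-th powers of the variables. -/
noncomputable def varPow (σ K : Type*) [Field K] (Q : ℕ) : Ideal (MvPolynomial σ K) :=
  Ideal.span (Set.range fun i => X i ^ Q)

theorem mem_varPow_iff {Q : ℕ} {u : MvPolynomial σ K} :
    u ∈ varPow σ K Q ↔ ∀ γ : σ →₀ ℕ, (∀ i, γ i < Q) → coeff γ u = 0 := by
  have h : varPow σ K Q = Ideal.span ((fun s => monomial s (1 : K)) ''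
      Set.range fun i => Finsupp.single i Q) := by
    rw [varPow, ← Set.range_comp]
    simp [Function.comp_def, X_pow_eq_monomial]
  rw [h, mem_ideal_span_monomial_image]
  refine forall_congr' fun γ => ?_
  rw [mem_support_iff, ← not_imp_not, not_not]
  refine imp_congr_left ?_
  simp

theorem map_mem_varPow_iff {L : Type*} [Field L] (φ : K →+* L) {Q : ℕ} {u : MvPolynomial σ K} :
    map φ u ∈ varPow σ L Q ↔ u ∈ varPow σ K Q := by
  simp [mem_varPow_iff, coeff_map]

theorem pderiv_mem_varPow {Q : ℕ} (hQ : (Q : K) = 0) (i : σ) {u : MvPolynomial σ K}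
    (hu : u ∈ varPow σ K Q) : pderiv i u ∈ varPow σ K Q := by
  induction hu using Submodule.span_induction with
  | mem x hx =>
    obtain ⟨j, rfl⟩ := hx
    have : ((Q : ℕ) : MvPolynomial σ K) = 0 := by rw [← map_natCast C, hQ, map_zero]
    simp [Derivation.leibniz_pow, this, nsmul_eq_mul]
  | zero => simp
  | add x y _ _ hx hy => simpa using add_mem hx hy
  | smul r x hx' hx =>
    rw [smul_eq_mul, Derivation.leibniz]
    exact add_mem (Ideal.mul_mem_left _ _ hx) (Ideal.mul_mem_right _ _ hx')

theorem mem_varPow_of_pow_mem_varPow {p : ℕ} [Fact p.Prime] [CharP K p] {s : ℕ}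
    {h : MvPolynomial σ K} (hh : h ^ p ∈ varPow σ K (s * p)) : h ∈ varPow σ K s := by
  have hp := Fact.out (p := p.Prime)
  rw [mem_varPow_iff] at hh ⊢
  intro γ hγ
  have := hh (p • γ) (fun i => by
    simpa [mul_comm] using Nat.mul_lt_mul_of_pos_right (hγ i) hp.pos)
  rw [← map_frobenius_expand, coeff_map, coeff_expand_smul _ hp.ne_zero] at this
  exact (map_eq_zero _).mp this

variable [Fintype σ]

theorem mem_varPow_of_mul_mem_of_infinite [Infinite K] [Nonempty σ] {N : ℕ} (hN : 0 < N)
    {f : MvPolynomial σ K} (hf : f.IsHomogeneous (N + 1))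
    (hrad : idealOfVars σ K ≤ (Ideal.span ({f} ∪ Set.range fun i => pderiv i f)).radical)
    {h : MvPolynomial σ K} {E Q : ℕ} (hh : h.IsHomogeneous E)
    (hE : E + N * Fintype.card σ + 1 < Fintype.card σ * Q) (hhf : h * f ∈ varPow σ K Q)
    (hhd : ∀ i, h * pderiv i f ∈ varPow σ K Q) : h ∈ varPow σ K Q := by
  rw [mem_varPow_iff]
  intro α hα
  by_contra hne
  have hαE : α.degree = E := degree_eq_of_isHomogeneous hh hne
  obtain ⟨Q, rfl⟩ : ∃ Q', Q = Q' + 1 :=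
    ⟨Q - 1, by have := hα (Classical.arbitrary σ); omega⟩
  set top := constExponent σ Q
  have hle : α ≤ top := fun i => Nat.lt_succ_iff.mp (hα i)
  have hdeg : (top - α).degree + E = Fintype.card σ * Q := by
    rw [← hαE, ← map_add, tsub_add_cancel_of_le hle, degree_constExponent]
  have hu : monomial (top - α) (1 : K) ∈ Ideal.span ({f} ∪ Set.range fun i => pderiv i f) := by
    refine mem_jacobian_of_degree hN hf hrad (isHomogeneous_monomial _ rfl) ?_
    rw [mul_add, mul_one] at hE
    omega
  have hmul : Ideal.span ({f} ∪ Set.range fun i => pderiv i f) ≤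
      Submodule.comap (LinearMap.mulLeft (MvPolynomial σ K) h) (varPow σ K (Q + 1)) := by
    rw [Ideal.span_le, Set.union_subset_iff, Set.singleton_subset_iff]
    refine ⟨hhf, ?_⟩
    rintro _ ⟨i, rfl⟩
    exact hhd i
  have := mem_varPow_iff.mp (hmul hu) top fun _ => Nat.lt_succ_self Q
  rw [LinearMap.mulLeft_apply, coeff_mul_monomial', if_pos tsub_le_self,
    tsub_tsub_cancel_of_le hle, mul_one] at this
  exact hne this

theorem mem_varPow_of_mul_mem [Nonempty σ] {N : ℕ} (hN : 0 < N)
    {f : MvPolynomial σ K} (hf : f.IsHomogeneous (N + 1))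
    (hrad : idealOfVars σ K ≤ (Ideal.span ({f} ∪ Set.range fun i => pderiv i f)).radical)
    {h : MvPolynomial σ K} {E Q : ℕ} (hh : h.IsHomogeneous E)
    (hE : E + N * Fintype.card σ + 1 < Fintype.card σ * Q) (hhf : h * f ∈ varPow σ K Q)
    (hhd : ∀ i, h * pderiv i f ∈ varPow σ K Q) : h ∈ varPow σ K Q := by
  set φ := algebraMap K (AlgebraicClosure K)
  have hspan : (Ideal.span ({f} ∪ Set.range fun i => pderiv i f)).map (map φ) =
      Ideal.span ({map φ f} ∪ Set.range fun i => pderiv i (map φ f)) := by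
    rw [Ideal.map_span, Set.image_union, Set.image_singleton, ← Set.range_comp]
    simp only [Function.comp_def, pderiv_map]
  rw [← map_mem_varPow_iff φ]
  refine mem_varPow_of_mul_mem_of_infinite hN (hf.map φ) ?_ (hh.map φ) hE ?_ fun i => ?_
  · rw [← hspan, Ideal.span_le]
    rintro _ ⟨i, rfl⟩
    obtain ⟨M, hM⟩ := hrad (Ideal.subset_span ⟨i, rfl⟩)
    refine ⟨M, ?_⟩
    simpa using Ideal.mem_map_of_mem (map φ) hM
  · rw [← map_mul, map_mem_varPow_iff]
    exact hhf
  · rw [pderiv_map, ← map_mul, map_mem_varPow_iff]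
    exact hhd i

theorem mem_varPow_of_mul_pow_mem {p : ℕ} [Fact p.Prime] [CharP K p] [Nonempty σ] {N : ℕ}
    (hN : 0 < N) (hcard : Fintype.card σ = N + 1) (hp : N ^ 2 < p + N + 1)
    {f : MvPolynomial σ K} (hf : f.IsHomogeneous (N + 1))
    (hrad : idealOfVars σ K ≤ (Ideal.span ({f} ∪ Set.range fun i => pderiv i f)).radical)
    {h : MvPolynomial σ K} {E s : ℕ} (hh : h.IsHomogeneous E)
    (hE : E + 1 + (N + 1) ≤ (N + 1) * s) (hmem : f ^ (p - 1) * h ^ p ∈ varPow σ K (s * p)) :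
    h ∈ varPow σ K s := by
  refine mem_varPow_of_pow_mem_varPow (p := p) ?_
  have hpp := Fact.out (p := p.Prime)
  have hs : ((s * p : ℕ) : K) = 0 := by simp
  have key : ∀ t, t < p → f ^ t * h ^ p ∈ varPow σ K (s * p) → h ^ p ∈ varPow σ K (s * p) := by
    intro t
    induction t with
    | zero => intro _ h; simpa using h
    | succ t ih =>
      intro ht hmem
      refine ih (by omega) (mem_varPow_of_mul_mem hN hf hrad
        (E := (N + 1) * t + E * p) ((hf.pow t).mul (hh.pow p)) ?_ ?_ fun i => ?_)
      · rw [hcard]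
        obtain ⟨r, rfl⟩ : ∃ r, p = t + 2 + r := ⟨p - (t + 2), by omega⟩
        have := Nat.mul_le_mul_right (t + 2 + r) hE
        nlinarith
      · convert hmem using 1
        ring
      · have hd := pderiv_mem_varPow hs i hmem
        have ht0 : ((t + 1 : ℕ) : K) ≠ 0 := by
          rw [Ne, CharP.cast_eq_zero_iff K p]
          exact Nat.not_dvd_of_pos_of_lt t.succ_pos ht
        have hdp : pderiv i (h ^ p) = 0 := by
          simp [Derivation.leibniz_pow, nsmul_eq_mul]
        have : C ((t + 1 : ℕ) : K)⁻¹ * C ((t + 1 : ℕ) : K) = (1 : MvPolynomial σ K) := by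
          rw [← C_mul, inv_mul_cancel₀ ht0, C_1]
        have hc := Ideal.mul_mem_left _ (C ((t + 1 : ℕ) : K)⁻¹) hd
        convert hc using 1
        rw [Derivation.leibniz, hdp, Derivation.leibniz_pow, smul_zero, zero_add,
          Nat.add_sub_cancel, nsmul_eq_mul, ← map_natCast (C : K →+* MvPolynomial σ K)]
        simp only [smul_eq_mul]
        linear_combination (-(f ^ t * h ^ p * pderiv i f)) * this
  exact key _ (Nat.sub_lt hpp.pos one_pos) hmem

theorem mem_varPow_of_pow_mul_pow_mem {p : ℕ} [Fact p.Prime] [CharP K p] [Nonempty σ] {N : ℕ}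
    (hN : 0 < N) (hcard : Fintype.card σ = N + 1) (hp : N ^ 2 < p + N + 1)
    {f : MvPolynomial σ K} (hf : f.IsHomogeneous (N + 1))
    (hrad : idealOfVars σ K ≤ (Ideal.span ({f} ∪ Set.range fun i => pderiv i f)).radical)
    {g : MvPolynomial σ K} (hg : g.IsHomogeneous N) (e : ℕ)
    (hmem : f ^ (p ^ e - 1) * g ^ p ^ e ∈ varPow σ K (2 * p ^ e)) : g ∈ varPow σ K 2 := by
  have hpp := Fact.out (p := p.Prime)
  induction e with
  | zero => simpa using hmem
  | succ e ih =>
    refine ih ?_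
    have hpe : 0 < p ^ e := pow_pos hpp.pos e
    refine mem_varPow_of_mul_pow_mem (p := p) hN hcard hp hf hrad
      (E := (N + 1) * (p ^ e - 1) + N * p ^ e) ((hf.pow _).mul (hg.pow _)) ?_ ?_
    · obtain ⟨r, hr⟩ : ∃ r, p ^ e = r + 1 := ⟨p ^ e - 1, by omega⟩
      rw [hr, Nat.add_sub_cancel]
      nlinarith
    · have hexp : p ^ (e + 1) - 1 = (p - 1) + (p ^ e - 1) * p := by
        rw [pow_succ_sub_one hpp.pos, add_comm, mul_comm p]
      rwa [mul_pow, ← pow_mul, ← pow_mul, ← pow_succ, ← mul_assoc, ← pow_add, ← hexp, mul_assoc,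
        ← pow_succ]

end VarPow

section RootIdeal

variable {σ K : Type*} [Field K] (p e : ℕ) [ExpChar K p] [PerfectRing K p]

/-- The component of `F` at the exponents congruent to `a` modulo `p ^ e`, with `p ^ e`-th roots
taken of its coefficients and of its monomials. -/
noncomputable def rootComponent (a : σ →₀ ℕ)
    (F : MvPolynomial σ K) : MvPolynomial σ K :=
  ∑ β ∈ F.support.preimage (fun β => p ^ e • β + a)
    ((add_left_injective a).comp (nsmul_right_injective (expChar_pow_pos K p e).ne')).injOn,
    monomial β ((iterateFrobeniusEquiv K p e).symm (coeff (p ^ e • β + a) F))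

variable {a : σ →₀ ℕ}

theorem coeff_rootComponent (F : MvPolynomial σ K) (β : σ →₀ ℕ) :
    coeff β (rootComponent p e a F) =
      (iterateFrobeniusEquiv K p e).symm (coeff (p ^ e • β + a) F) := by
  classical
  simp only [rootComponent, coeff_sum, coeff_monomial, Finset.sum_ite_eq', Finset.mem_preimage,
    mem_support_iff]
  split_ifs with h
  · rfl
  · rw [not_not.mp h, map_zero]

theorem rootComponent_add (F G : MvPolynomial σ K) :
    rootComponent p e a (F + G) = rootComponent p e a F + rootComponent p e a G := by
  ext β
  simp [coeff_rootComponent]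

theorem rootComponent_pow_mul (ha : ∀ i, a i < p ^ e)
    (l F : MvPolynomial σ K) :
    rootComponent p e a (l ^ p ^ e * F) = l * rootComponent p e a F := by
  induction l using MvPolynomial.induction_on' with
  | monomial μ c =>
    ext β
    have hiff : p ^ e • μ ≤ p ^ e • β + a ↔ μ ≤ β := by
      refine forall_congr' fun i => ?_
      have := ha i
      simp only [Finsupp.smul_apply, Finsupp.add_apply, smul_eq_mul]
      constructor
      · intro h
        by_contra! hlt
        have := Nat.mul_le_mul_left (p ^ e) (Nat.succ_le_of_lt hlt)
        rw [Nat.mul_succ] at this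
        omega
      · intro h
        exact (Nat.mul_le_mul_left (p ^ e) h).trans (Nat.le_add_right _ _)
    rw [coeff_rootComponent, monomial_pow, coeff_monomial_mul', coeff_monomial_mul']
    simp only [hiff]
    split_ifs with h
    · rw [map_mul, ← iterateFrobeniusEquiv_def, RingEquiv.symm_apply_apply, coeff_rootComponent,
        ← tsub_add_eq_add_tsub (nsmul_le_nsmul_right h _)]
      congr 3
      ext i
      simp [Nat.mul_sub]
    · exact map_zero _
  | add l l' hl hl' =>
    rw [add_pow_expChar_pow, add_mul, rootComponent_add, hl, hl', add_mul]

theorem rootComponent_mem (ha : ∀ i, a i < p ^ e)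
    {L : Ideal (MvPolynomial σ K)} {F : MvPolynomial σ K} (hF : F ∈ bracketPow L (p ^ e)) :
    rootComponent p e a F ∈ L := by
  suffices ∀ r, rootComponent p e a (F * r) ∈ L by simpa using this 1
  induction hF using Submodule.span_induction with
  | mem x hx =>
    obtain ⟨l, hl, rfl⟩ := hx
    intro r
    rw [rootComponent_pow_mul p e ha]
    exact Ideal.mul_mem_right _ _ hl
  | zero =>
    intro r
    convert L.zero_mem
    ext β
    simp [coeff_rootComponent]
  | add x y _ _ hx hy =>
    intro r
    rw [add_mul, rootComponent_add]
    exact add_mem (hx r) (hy r)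
  | smul s x _ hx =>
    intro r
    rw [smul_eq_mul, mul_comm s, mul_assoc]
    exact hx _

theorem coeff_rootComponent_pow (F : MvPolynomial σ K) (β : σ →₀ ℕ) :
    coeff β (rootComponent p e a F) ^ p ^ e = coeff (p ^ e • β + a) F := by
  rw [coeff_rootComponent, ← iterateFrobeniusEquiv_def, RingEquiv.apply_symm_apply]

theorem isHomogeneous_rootComponent {F : MvPolynomial σ K} {D : ℕ}
    (hF : F.IsHomogeneous (p ^ e * D + a.degree)) : (rootComponent p e a F).IsHomogeneous D := by
  intro β hβ
  rw [coeff_rootComponent, map_ne_zero_iff _ (RingEquiv.injective _)] at hβ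
  have h := degree_eq_of_isHomogeneous hF hβ
  rw [map_add, map_nsmul, smul_eq_mul, add_left_inj] at h
  change Finsupp.weight (fun _ => 1) β = D
  rw [← Finsupp.degree_eq_weight_one]
  exact Nat.eq_of_mul_eq_mul_left (expChar_pow_pos K p e) h

theorem coeff_eq_zero_of_mem_bracketPow (ha : ∀ i, a i < p ^ e) {L : Ideal (MvPolynomial σ K)}
    (hL : L ≠ ⊤) {F : MvPolynomial σ K} (hF : F ∈ bracketPow L (p ^ e))
    (hhom : F.IsHomogeneous a.degree) : coeff a F = 0 := by
  have hr := rootComponent_mem p e ha hF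
  have h0 : (rootComponent p e a F).IsHomogeneous 0 :=
    isHomogeneous_rootComponent p e (by simpa using hhom)
  rw [totalDegree_eq_zero_iff_eq_C.mp (Nat.le_zero.mp h0.totalDegree_le)] at hr
  by_contra hne
  refine hL (Ideal.eq_top_of_isUnit_mem _ hr (IsUnit.map C (Ne.isUnit fun h => hne ?_)))
  have := coeff_rootComponent_pow p e (a := a) F 0
  rw [h, zero_pow (expChar_pow_pos K p e).ne'] at this
  simpa using this.symm

theorem eq_sum_of_isHomogeneous_one [Fintype σ] {u : MvPolynomial σ K} (hu : u.IsHomogeneous 1) :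
    u = ∑ i, coeff (Finsupp.single i 1) u • X i := by
  classical
  ext β
  simp only [coeff_sum, coeff_smul, coeff_X, smul_eq_mul, mul_ite, mul_one, mul_zero]
  by_cases hβ : ∃ i, Finsupp.single i 1 = β
  · obtain ⟨i, rfl⟩ := hβ
    simp [Finsupp.single_left_inj]
  · rw [Finset.sum_eq_zero fun i _ => if_neg fun h => hβ ⟨i, h⟩]
    by_contra hne
    have := degree_eq_of_isHomogeneous hu hne
    obtain ⟨i, rfl⟩ := (Finsupp.sum_eq_one_iff β).mp this
    exact hβ ⟨i, rfl⟩

theorem sum_pow_mul_coeff_eq_zero [Fintype σ] (ha : ∀ i, a i < p ^ e)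
    {L : Ideal (MvPolynomial σ K)} {F : MvPolynomial σ K} (hF : F ∈ bracketPow L (p ^ e))
    (hhom : F.IsHomogeneous (p ^ e + a.degree)) {c : σ → K}
    (hc : ∀ b : σ → K, ∑ i, b i • X i ∈ L → ∑ i, b i * c i = 0) :
    ∑ i, c i ^ p ^ e * coeff (p ^ e • Finsupp.single i 1 + a) F = 0 := by
  have hr := rootComponent_mem p e ha hF
  rw [eq_sum_of_isHomogeneous_one
    (isHomogeneous_rootComponent p e (by simpa using hhom))] at hr
  simp_rw [← coeff_rootComponent_pow p e, ← mul_pow]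
  rw [← sum_pow_char_pow]
  simp_rw [mul_comm (c _)]
  rw [hc _ hr]
  exact zero_pow (Nat.ne_of_gt (expChar_pow_pos K p e))

/-- The exponent of the product of all variables other than the `i`-th one. -/
noncomputable def coSingle [Fintype σ] [DecidableEq σ] (i : σ) : σ →₀ ℕ :=
  Finsupp.equivFunOnFinite.symm fun j => if j = i then 0 else 1

theorem coSingle_apply [Fintype σ] [DecidableEq σ] (i j : σ) :
    coSingle i j = if j = i then 0 else 1 := rfl

theorem degree_coSingle [Fintype σ] [DecidableEq σ] {N : ℕ} (hcard : Fintype.card σ = N + 1)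
    (i : σ) : (coSingle i).degree = N := by
  rw [Finsupp.degree_eq_sum, ← Finset.add_sum_erase _ _ (Finset.mem_univ i), coSingle_apply,
    if_pos rfl, zero_add, Finset.sum_congr rfl (g := fun _ => 1)]
  · simp [hcard]
  · intro j hj
    rw [coSingle_apply, if_neg (Finset.ne_of_mem_erase hj)]

/-- If `c` annihilates the coefficient vectors of all linear forms in a proper ideal `L`, then
`F ∈ L^{[p ^ e]}` multiplies `(∑ i, c i * ∏ j ≠ i, X j) ^ p ^ e` into the ideal generated by the
`X i ^ (2 * p ^ e)`. -/
theorem mul_pow_mem_varPow [Fintype σ] [DecidableEq σ] {N : ℕ} (hcard : Fintype.card σ = N + 1)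
    {L : Ideal (MvPolynomial σ K)} (hL : L ≠ ⊤) {F : MvPolynomial σ K}
    (hF : F ∈ bracketPow L (p ^ e)) (hhom : F.IsHomogeneous ((N + 1) * (p ^ e - 1))) {c : σ → K}
    (hc : ∀ b : σ → K, ∑ i, b i • X i ∈ L → ∑ i, b i * c i = 0) :
    F * (∑ i, monomial (coSingle i) (c i)) ^ p ^ e ∈ varPow σ K (2 * p ^ e) := by
  rw [mem_varPow_iff]
  intro γ hγ
  have hq : 0 < p ^ e := expChar_pow_pos K p e
  have hghom : (∑ i, monomial (coSingle i) (c i)).IsHomogeneous N :=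
    IsHomogeneous.sum _ _ _ fun i _ => isHomogeneous_monomial _ (degree_coSingle hcard i)
  by_contra hne
  have hdeg := degree_eq_of_isHomogeneous (hhom.mul (hghom.pow _)) hne
  rw [sum_pow_char_pow, Finset.mul_sum, coeff_sum] at hne
  simp_rw [monomial_pow, coeff_mul_monomial'] at hne
  by_cases hall : ∀ i, p ^ e ≤ γ i
  · set a : σ →₀ ℕ := Finsupp.equivFunOnFinite.symm fun i => γ i - p ^ e
    have hai : ∀ i, a i = γ i - p ^ e := fun i => rfl
    have haq : ∀ i, a i < p ^ e := fun i => by have := hγ i; rw [hai]; omega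
    have hadeg : a.degree + (N + 1) * p ^ e = γ.degree := by
      rw [Finsupp.degree_eq_sum, Finsupp.degree_eq_sum, ← hcard, ← smul_eq_mul, ← Finset.card_univ,
        ← Finset.sum_const, ← Finset.sum_add_distrib]
      exact Finset.sum_congr rfl fun i _ => by rw [hai, Nat.sub_add_cancel (hall i)]
    refine hne ((Finset.sum_congr rfl fun i _ => ?_).trans
      (sum_pow_mul_coeff_eq_zero p e haq hF ?_ hc))
    · rw [if_pos, mul_comm]
      · congr 2
        ext j
        have := hall j
        rcases eq_or_ne j i with rfl | hij
        · simp [coSingle_apply, hai, Nat.add_sub_cancel' this]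
        · simp [coSingle_apply, hij, hai]
      · intro j
        have := hall j
        by_cases hij : j = i <;> simp [coSingle_apply, hij, hall]
    · convert hhom using 1
      rw [hdeg] at hadeg
      obtain ⟨r, hr⟩ : ∃ r, p ^ e = r + 1 := ⟨p ^ e - 1, by omega⟩
      rw [hr, Nat.add_sub_cancel] at hadeg ⊢
      linarith
  · push Not at hall
    obtain ⟨i, hi⟩ := hall
    have hsum : ∑ j, (2 * p ^ e - 1 - γ j) = p ^ e := by
      have : ∑ j, (2 * p ^ e - 1 - γ j) + γ.degree = (N + 1) * (2 * p ^ e - 1) := by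
        rw [Finsupp.degree_eq_sum, ← Finset.sum_add_distrib, ← hcard,
          ← smul_eq_mul (Fintype.card σ), ← Finset.card_univ, ← Finset.sum_const]
        exact Finset.sum_congr rfl fun j _ => by have := hγ j; omega
      obtain ⟨r, hr⟩ : ∃ r, p ^ e = r + 1 := ⟨p ^ e - 1, by omega⟩
      rw [hdeg] at this
      rw [hr, show 2 * (r + 1) - 1 = 2 * r + 1 by omega, Nat.add_sub_cancel] at this
      rw [hr, show 2 * (r + 1) - 1 = 2 * r + 1 by omega]
      linarith
    rw [← Finset.add_sum_erase _ _ (Finset.mem_univ i)] at hsum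
    have hγi : γ i = p ^ e - 1 := by omega
    have hγj : ∀ j, j ≠ i → γ j = 2 * p ^ e - 1 := fun j hj => by
      have h0 : ∑ j ∈ Finset.univ.erase i, (2 * p ^ e - 1 - γ j) = 0 := by omega
      have := Finset.sum_eq_zero_iff.mp h0 j (by simp [hj])
      have := hγ j
      omega
    set a := constExponent σ (p ^ e - 1)
    have hai : ∀ i, a i = p ^ e - 1 := constExponent_apply _
    have hcoeff : coeff a F = 0 := coeff_eq_zero_of_mem_bracketPow p e
      (fun i => by rw [hai]; omega) hL hF (by
        convert hhom using 1
        rw [degree_constExponent, hcard])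
    refine hne (Finset.sum_eq_zero fun j _ => ?_)
    by_cases hj : j = i
    · rw [show γ - p ^ e • coSingle j = a from ?_, hcoeff, zero_mul, ite_self]
      ext l
      by_cases hl : l = i
      · simp [hl, hj, coSingle_apply, hai, hγi]
      · simp [hl, hj, coSingle_apply, hai, hγj l hl]
        omega
    · rw [if_neg]
      intro hle
      have := hle i
      simp [coSingle_apply, Ne.symm hj] at this
      omega

theorem idealOfVars_le_of_mem_bracketPow [Fintype σ] [Nonempty σ] [Fact p.Prime] [CharP K p]
    {N : ℕ} (hN : 0 < N) (hcard : Fintype.card σ = N + 1) (hp : N ^ 2 < p + N + 1)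
    {f : MvPolynomial σ K} (hf : f.IsHomogeneous (N + 1))
    (hrad : idealOfVars σ K ≤ (Ideal.span ({f} ∪ Set.range fun i => pderiv i f)).radical)
    {L : Ideal (MvPolynomial σ K)} (hmem : f ^ (p ^ e - 1) ∈ bracketPow L (p ^ e)) :
    idealOfVars σ K ≤ L := by
  classical
  by_contra hle
  have hL : L ≠ ⊤ := by
    rintro rfl
    exact hle le_top
  have hlt : (L.restrictScalars K).comap
      (Fintype.linearCombination K (X : σ → MvPolynomial σ K)) < ⊤ := by
    rw [lt_top_iff_ne_top]
    intro htop
    refine hle (Ideal.span_le.mpr ?_)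
    rintro _ ⟨i, rfl⟩
    have : (Pi.single i 1 : σ → K) ∈ (L.restrictScalars K).comap
      (Fintype.linearCombination K (X : σ → MvPolynomial σ K)) := htop ▸ trivial
    simpa [Fintype.linearCombination_apply_single] using this
  obtain ⟨ℓ, hℓ, hker⟩ := Submodule.exists_le_ker_of_lt_top _ hlt
  set c : σ → K := fun i => ℓ (Pi.single i 1) with hcdef
  have hℓc : ∀ b, ℓ b = ∑ i, b i * c i := fun b => by
    rw [LinearMap.pi_apply_eq_sum_univ ℓ b]
    refine Finset.sum_congr rfl fun i _ => ?_
    rw [smul_eq_mul, hcdef]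
    congr 2
    ext j
    simp [Pi.single_apply, eq_comm]
  have hg := mem_varPow_of_pow_mul_pow_mem hN hcard hp hf hrad
    (IsHomogeneous.sum _ _ _ fun i _ => isHomogeneous_monomial _ ?_) e
    (mul_pow_mem_varPow p e hcard hL hmem (hf.pow _) (c := c) fun b hb => ?_)
  · refine hℓ (LinearMap.ext fun b => ?_)
    rw [hℓc, LinearMap.zero_apply]
    refine Finset.sum_eq_zero fun i _ => ?_
    have h := mem_varPow_iff.mp hg (coSingle i) fun j => by
      rw [coSingle_apply]
      split_ifs <;> norm_num
    rw [coeff_sum, Finset.sum_eq_single i, coeff_monomial, if_pos rfl] at h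
    · rw [h, mul_zero]
    · intro j _ hj
      rw [coeff_monomial, if_neg]
      intro h
      have := DFunLike.congr_fun h i
      simp [coSingle_apply, hj.symm] at this
    · simp
  · exact degree_coSingle hcard i
  · rw [← hℓc]
    exact hker hb

theorem pow_mem_bracketPow {R : Type*} [CommRing R] {q m : ℕ} (p : ℕ) [ExpChar R p] {L : Ideal R}
    {x : R} (hx : x ∈ bracketPow L q) : x ^ p ^ m ∈ bracketPow L (q * p ^ m) := by
  induction hx using Submodule.span_induction with
  | mem x hx =>
    obtain ⟨l, hl, rfl⟩ := hx
    exact Ideal.subset_span ⟨l, hl, pow_mul _ _ _⟩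
  | zero => simp [zero_pow (expChar_pow_pos R p m).ne']
  | add x y _ _ hx hy =>
    rw [add_pow_expChar_pow]
    exact add_mem hx hy
  | smul r x _ hx =>
    rw [smul_eq_mul, mul_pow]
    exact Ideal.mul_mem_left _ _ hx

theorem varPow_le_bracketPow (σ K : Type*) [Field K] (q : ℕ) :
    varPow σ K q ≤ bracketPow (idealOfVars σ K) q := by
  refine Ideal.span_mono ?_
  rintro _ ⟨i, rfl⟩
  exact ⟨X i, Ideal.subset_span ⟨i, rfl⟩, rfl⟩

theorem mem_varPow_of_coeff_eq_zero [Fintype σ] {q : ℕ} {F : MvPolynomial σ K}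
    (hhom : F.IsHomogeneous (Fintype.card σ * (q - 1)))
    (hF : coeff (constExponent σ (q - 1)) F = 0) : F ∈ varPow σ K q := by
  rw [mem_varPow_iff]
  intro γ hγ
  by_contra hne
  refine hne ?_
  suffices γ = constExponent σ (q - 1) by rwa [this]
  have hdeg := degree_eq_of_isHomogeneous hhom hne
  rw [← degree_constExponent, Finsupp.degree_eq_sum, Finsupp.degree_eq_sum] at hdeg
  have hle : ∀ i ∈ Finset.univ, γ i ≤ constExponent σ (q - 1) i := fun i _ => by
    rw [constExponent_apply]
    exact Nat.le_sub_one_of_lt (hγ i)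
  exact Finsupp.ext fun i => (Finset.sum_eq_sum_iff_of_le hle).mp hdeg i (Finset.mem_univ i)

theorem coeff_pow_eq_zero_of_coeff_pow_eq_zero [Fintype σ] {f : MvPolynomial σ K}
    (hf : f.IsHomogeneous (Fintype.card σ))
    (h : coeff (constExponent σ (p ^ e - 1)) (f ^ (p ^ e - 1)) = 0) :
    coeff (constExponent σ (p - 1)) (f ^ (p - 1)) = 0 := by
  have hp : 0 < p := expChar_pos K p
  induction e with
  | zero =>
    have h0 : constExponent σ 0 = 0 := Finsupp.ext fun _ => rfl
    simp [h0] at h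
  | succ e ih =>
    set a := constExponent σ (p - 1)
    have ha : ∀ i, a i < p ^ 1 := fun i => by
      rw [constExponent_apply, pow_one]
      omega
    have hhom : (rootComponent p 1 a (f ^ (p - 1))).IsHomogeneous 0 := by
      refine isHomogeneous_rootComponent p 1 ?_
      rw [mul_zero, zero_add, degree_constExponent]
      exact hf.pow _
    have hmul := rootComponent_pow_mul p 1 ha (f ^ (p ^ e - 1)) (f ^ (p - 1))
    rw [totalDegree_eq_zero_iff_eq_C.mp (Nat.le_zero.mp hhom.totalDegree_le)] at hmul
    have hcoeff := congrArg (coeff (constExponent σ (p ^ e - 1))) hmul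
    have hexp : p ^ 1 • constExponent σ (p ^ e - 1) + a = constExponent σ (p ^ (e + 1) - 1) := by
      ext i
      simp [a, constExponent_apply, pow_succ_sub_one hp]
    rw [coeff_rootComponent, mul_comm _ (C _), coeff_C_mul, hexp, ← pow_mul, ← pow_add, pow_one,
      mul_comm _ p, ← pow_succ_sub_one hp, h, map_zero, eq_comm, mul_eq_zero] at hcoeff
    rcases hcoeff.symm with h0 | h0
    · exact ih h0
    · rw [coeff_rootComponent, map_eq_zero_iff _ (RingEquiv.injective _)] at h0
      simpa using h0

end RootIdeal

/-- For a Calabi–Yau hypersurface `Proj(R/fR)` (i.e. `f` homogeneous of degree `n+1`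
defining a smooth hypersurface) in characteristic `p > max(2, n²-n-1)`, the chain
`(f^{p^e-1})^{[1/p^e]}` is constant from `e = 1` on: the level of `f` is at most `2`
(equivalently, the Hartshorne–Speiser–Lyubeznik number is `1`). -/
theorem calabiYau_level_le_two {k : Type*} [Field k] [PerfectField k]
    {p n : ℕ} [CharP k p] (hn : 2 ≤ n) (hp2 : 2 < p) (hpn : n ^ 2 - n - 1 < p)
    (f : MvPolynomial (Fin (n + 1)) k) (hhom : f.IsHomogeneous (n + 1))
    (hsmooth : (Ideal.span ({f} ∪ Set.range fun i : Fin (n + 1) => pderiv i f)).radical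
        = Ideal.span (Set.range (X : Fin (n + 1) → MvPolynomial (Fin (n + 1)) k))) :
    ∀ e : ℕ, 1 ≤ e →
      rootIdeal (f ^ (p - 1)) p = rootIdeal (f ^ (p ^ e - 1)) (p ^ e) := by
  intro e he
  have hprime : p.Prime := (CharP.char_is_prime_or_zero k p).resolve_right (by omega)
  have : Fact p.Prime := ⟨hprime⟩
  have : PerfectRing k p := PerfectField.toPerfectRing p
  have hcard : Fintype.card (Fin (n + 1)) = n + 1 := Fintype.card_fin _
  refine le_antisymm (le_sInf fun L hL => ?_) (le_sInf fun L hL => sInf_le ?_)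
  · rcases eq_or_ne L ⊤ with rfl | hne
    · exact le_top
    have hle : idealOfVars (Fin (n + 1)) k ≤ L := idealOfVars_le_of_mem_bracketPow p e
      (by omega) hcard (by omega) hhom hsmooth.ge hL
    refine le_trans (sInf_le (varPow_le_bracketPow _ _ _
      (mem_varPow_of_coeff_eq_zero (by simpa using hhom.pow (p - 1)) ?_))) hle
    refine coeff_pow_eq_zero_of_coeff_pow_eq_zero p e (by simpa using hhom)
      (coeff_eq_zero_of_mem_bracketPow p e (fun i => ?_) hne hL ?_)
    · have := expChar_pow_pos k p e
      rw [constExponent_apply]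
      omega
    · rw [degree_constExponent, hcard]
      exact hhom.pow _
  · obtain ⟨m, rfl⟩ := Nat.exists_eq_add_of_le' he
    have hmem := Ideal.mul_mem_right (f ^ (p ^ m - 1)) _ (pow_mem_bracketPow (m := m) p hL)
    rw [Set.mem_ofPred_eq]
    convert hmem using 1
    · rw [pow_succ']
    · rw [← pow_mul, ← pow_add]
      congr 1
      have h1 : 0 < p ^ m := expChar_pow_pos k p m
      have h2 : p ^ m ≤ p * p ^ m := Nat.le_mul_of_pos_left _ hprime.pos
      rw [pow_succ', Nat.sub_mul, one_mul]
      omega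
end

section
/- Let p be a prime and n ≥ 1 an integer with p ≡ 1 (mod n+1). Then the monomial (x₀x₁⋯x_n)^{p−1} appears with nonzero coefficient in f_n^{p−1} ∈ 𝔽_p[x₀,…,x_n]; equivalently, the multinomial coefficient (p−1)! / (((p−1)/(n+1))!)^{n+1} is not divisible by p. -/
open MvPolynomial

/-- The Fermat polynomial `f_n = x₀^{n+1} + … + x_n^{n+1}` over `𝔽_p`. -/
noncomputable def fermat (p n : ℕ) : MvPolynomial (Fin (n + 1)) (ZMod p) :=
  ∑ i : Fin (n + 1), X i ^ (n + 1)

/-- The multinomial coefficient of a constant family. -/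
theorem multinomial_univ_const (n m : ℕ) :
    Nat.multinomial Finset.univ (fun _ : Fin n => m) =
      Nat.factorial (n * m) / Nat.factorial m ^ n := by
  simp [Nat.multinomial]

/-- A multinomial coefficient of total degree less than a prime `p` is prime to `p`. -/
theorem Nat.Prime.not_dvd_multinomial {ι : Type*} {p : ℕ} (hp : p.Prime) (s : Finset ι)
    (k : ι → ℕ) (hk : ∑ i ∈ s, k i < p) : ¬ p ∣ Nat.multinomial s k := fun h => by
  have h' : p ∣ (∑ i ∈ s, k i).factorial := by
    rw [← Nat.multinomial_spec s k]
    exact h.mul_left _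
  exact absurd (hp.dvd_factorial.mp h') (not_le.mpr hk)

/-- The coefficient of `∏ x_i^{d k_i}` in `(∑ x_i^d)^N`, where `N = ∑ k_i`, is multinomial. -/
theorem MvPolynomial.coeff_sum_X_pow_pow {σ R : Type*} [Fintype σ] [CommSemiring R]
    {d : ℕ} (hd : d ≠ 0) (k : σ → ℕ) :
    coeff (Finsupp.equivFunOnFinite.symm fun i => d * k i)
        ((∑ i : σ, X i ^ d : MvPolynomial σ R) ^ ∑ i, k i) =
      Nat.multinomial Finset.univ k := by
  classical
  have hmon (l : σ → ℕ) : (∏ i, (X i ^ d) ^ l i : MvPolynomial σ R) =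
      monomial (Finsupp.equivFunOnFinite.symm fun i => d * l i) 1 := by
    rw [monomial_eq, Finsupp.prod_fintype _ _ (by simp)]
    simp [pow_mul]
  rw [Finset.sum_pow_eq_sum_piAntidiag, coeff_sum, Finset.sum_eq_single k]
  · rw [hmon, ← map_natCast (C : R →+* MvPolynomial σ R), coeff_C_mul, coeff_monomial]
    simp
  · intro l _ hl
    rw [hmon, ← map_natCast (C : R →+* MvPolynomial σ R), coeff_C_mul, coeff_monomial,
      if_neg, mul_zero]
    intro h
    refine hl (_root_.funext fun i => ?_)
    exact Nat.eq_of_mul_eq_mul_left (Nat.pos_of_ne_zero hd)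
      (congrFun (Finsupp.equivFunOnFinite.symm.injective h) i)
  · intro h
    simp at h

/-- If `p ≡ 1 (mod n+1)` then `(x₀⋯x_n)^{p-1}` appears with nonzero coefficient in
`f_n^{p-1}`; equivalently the multinomial coefficient
`(p-1)! / (((p-1)/(n+1))!)^{n+1}` is not divisible by `p`. -/
theorem fermat_monomial_nonzero (p n : ℕ) (hp : p.Prime) (hn : 1 ≤ n)
    (hmod : p % (n + 1) = 1) :
    MvPolynomial.coeff (Finsupp.equivFunOnFinite.symm fun _ : Fin (n + 1) => p - 1)
        ((fermat p n) ^ (p - 1)) ≠ 0 ∧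
    ¬ p ∣ Nat.factorial (p - 1) / (Nat.factorial ((p - 1) / (n + 1))) ^ (n + 1) := by
  obtain ⟨m, hm⟩ : n + 1 ∣ p - 1 := by
    simpa only [hmod] using Nat.dvd_sub_mod (n := n + 1) p
  have hsum : ∑ _i : Fin (n + 1), m = p - 1 := by simp [hm]
  have hndvd : ¬ p ∣ Nat.multinomial Finset.univ (fun _ : Fin (n + 1) => m) :=
    hp.not_dvd_multinomial _ _ (by rw [hsum]; exact Nat.sub_lt hp.pos one_pos)
  constructor
  · have hcoeff := coeff_sum_X_pow_pow (R := ZMod p) n.succ_ne_zero fun _ : Fin (n + 1) => m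
    rw [hsum, Nat.succ_eq_add_one, ← hm] at hcoeff
    rwa [fermat, hcoeff, Ne, ZMod.natCast_eq_zero_iff]
  · rwa [hm, Nat.mul_div_cancel_left _ n.succ_pos, ← multinomial_univ_const]
end

section
/- Let p be a prime with p > n ≥ 2 and p ≡ 1 (mod n+1). Then the polynomial (D_{p−1,0} ∘ D_{p−1,1} ∘ ⋯ ∘ D_{p−1,n})(f_n^{p−1}) ∈ 𝔽_p[x₀,…,x_n] is a nonzero constant; that is, the operator Ψ₁ = ∏_{i=0}^{n} D_{p−1,i} sends f_n^{p−1} to a nonzero element of 𝔽_p (so Ψ₁ is, up to a nonzero constant, an operator of level 1 for f_n). -/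
open MvPolynomial

/-- The differential operator `D_{t,i}`, acting on a monomial `x₀^{a₀}⋯x_n^{a_n}` by
`D_{t,i}(x₀^{a₀}⋯x_n^{a_n}) = C(a_i, t) · x₀^{a₀}⋯x_i^{a_i-t}⋯x_n^{a_n}` if `a_i ≥ t`,
and by `0` otherwise. -/
noncomputable def Dop (p n t : ℕ) (i : Fin (n + 1))
    (g : MvPolynomial (Fin (n + 1)) (ZMod p)) : MvPolynomial (Fin (n + 1)) (ZMod p) :=
  ∑ d ∈ g.support,
    if t ≤ d i then
      monomial (d - Finsupp.single i t) ((((d i).choose t : ℕ) : ZMod p) * coeff d g)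
    else 0

/-- The composite operator `Ψ = D_{t,0} ∘ D_{t,1} ∘ ⋯ ∘ D_{t,n}`. -/
noncomputable def Psi (p n t : ℕ) :
    MvPolynomial (Fin (n + 1)) (ZMod p) → MvPolynomial (Fin (n + 1)) (ZMod p) :=
  (List.ofFn fun i : Fin (n + 1) => Dop p n t i).foldr (· ∘ ·) id

lemma coeff_Dop (p n t : ℕ) (i : Fin (n + 1)) (g : MvPolynomial (Fin (n + 1)) (ZMod p))
    (e : Fin (n + 1) →₀ ℕ) :
    coeff e (Dop p n t i g) =
      ((e i + t).choose t : ZMod p) * coeff (e + Finsupp.single i t) g := by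
  have key : ∀ d : Fin (n + 1) →₀ ℕ,
      coeff e (if t ≤ d i then
        monomial (d - Finsupp.single i t) ((((d i).choose t : ℕ) : ZMod p) * coeff d g)
        else 0) =
      if d = e + Finsupp.single i t then
        ((e i + t).choose t : ZMod p) * coeff (e + Finsupp.single i t) g else 0 := by
    intro d
    by_cases hd : d = e + Finsupp.single i t
    · subst hd
      simp
    · rw [if_neg hd]
      split_ifs with ht
      · rw [coeff_monomial, if_neg]
        rintro rfl
        exact hd (tsub_add_cancel_of_le (Finsupp.single_le_iff.mpr ht)).symm
      · simp
  rw [Dop, coeff_sum, Finset.sum_congr rfl fun d _ => key d, Finset.sum_ite_eq']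
  split_ifs with h
  · rfl
  · rw [notMem_support_iff.mp h, mul_zero]

lemma coeff_foldr_Dop (p n t : ℕ) (g : MvPolynomial (Fin (n + 1)) (ZMod p))
    (l : List (Fin (n + 1))) (hl : l.Nodup) (e : Fin (n + 1) →₀ ℕ) :
    coeff e ((l.map (Dop p n t)).foldr (· ∘ ·) id g) =
      (l.map fun i => ((e i + t).choose t : ZMod p)).prod *
        coeff (e + (l.map fun i => Finsupp.single i t).sum) g := by
  induction l generalizing e with
  | nil => simp
  | cons i l ih =>
    obtain ⟨hi, hl⟩ := List.nodup_cons.mp hl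
    have hmap : (l.map fun j => (((e + Finsupp.single i t) j + t).choose t : ZMod p)) =
        l.map fun j => ((e j + t).choose t : ZMod p) := by
      refine List.map_congr_left fun j hj => ?_
      have hij : i ≠ j := fun h => hi (h ▸ hj)
      simp [Finsupp.single_eq_of_ne' hij]
    simp only [List.map_cons, List.foldr_cons, Function.comp_apply, List.prod_cons,
      List.sum_cons]
    rw [coeff_Dop, ih hl, hmap, mul_assoc, add_assoc]

lemma coeff_Psi (p n t : ℕ) (g : MvPolynomial (Fin (n + 1)) (ZMod p))
    (e : Fin (n + 1) →₀ ℕ) :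
    coeff e (Psi p n t g) =
      (∏ i, ((e i + t).choose t : ZMod p)) *
        coeff (e + Finsupp.equivFunOnFinite.symm fun _ => t) g := by
  have hsum : ((List.finRange (n + 1)).map fun i => Finsupp.single i t).sum =
      Finsupp.equivFunOnFinite.symm fun _ => t := by
    rw [← List.ofFn_eq_map, List.sum_ofFn]
    ext j
    simp [Finsupp.finsetSum_apply, Finsupp.single_apply]
  rw [Psi, List.ofFn_eq_map, coeff_foldr_Dop p n t g _ (List.nodup_finRange _), hsum,
    ← List.ofFn_eq_map, List.prod_ofFn]

lemma isHomogeneous_fermat (p n : ℕ) : (fermat p n).IsHomogeneous (n + 1) :=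
  IsHomogeneous.sum _ _ _ fun i _ => isHomogeneous_X_pow i (n + 1)

lemma coeff_fermat_pow (p n m : ℕ) :
    coeff (Finsupp.equivFunOnFinite.symm fun _ => (n + 1) * m)
      (fermat p n ^ ((n + 1) * m)) =
      (Nat.multinomial Finset.univ fun _ : Fin (n + 1) => m : ZMod p) := by
  have hterm : ∀ k : Fin (n + 1) → ℕ,
      coeff (Finsupp.equivFunOnFinite.symm fun _ => (n + 1) * m)
        ((Nat.multinomial Finset.univ k : MvPolynomial (Fin (n + 1)) (ZMod p)) *
          ∏ i, (X i ^ (n + 1)) ^ k i) =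
      if k = fun _ => m then
        (Nat.multinomial Finset.univ fun _ : Fin (n + 1) => m : ZMod p) else 0 := by
    intro k
    have hmon : (∏ i, (X i ^ (n + 1)) ^ k i : MvPolynomial (Fin (n + 1)) (ZMod p)) =
        monomial (Finsupp.equivFunOnFinite.symm fun i => (n + 1) * k i) 1 := by
      rw [monomial_eq, Finsupp.prod_fintype _ _ fun i => pow_zero _]
      simp [pow_mul]
    rw [hmon, ← map_natCast (C (σ := Fin (n + 1)) (R := ZMod p)), coeff_C_mul, coeff_monomial]
    by_cases hk : k = fun _ => m
    · simp [hk]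
    · rw [if_neg hk, if_neg, mul_zero]
      intro h
      refine hk (funext fun i => ?_)
      exact Nat.eq_of_mul_eq_mul_left n.succ_pos
        (congrFun (Finsupp.equivFunOnFinite.symm.injective h) i)
  rw [fermat, Finset.sum_pow_eq_sum_piAntidiag, coeff_sum,
    Finset.sum_congr rfl fun k _ => hterm k, Finset.sum_ite_eq', if_pos]
  simp [Finset.mem_piAntidiag]

lemma natCast_multinomial_ne_zero {ι : Type*} {p : ℕ} (hp : p.Prime) (s : Finset ι)
    (k : ι → ℕ) (hk : ∑ i ∈ s, k i < p) : (Nat.multinomial s k : ZMod p) ≠ 0 := by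
  rw [Ne, ZMod.natCast_eq_zero_iff]
  intro h
  have hdvd : p ∣ (∑ i ∈ s, k i).factorial :=
    Nat.multinomial_spec s k ▸ h.mul_left _
  exact absurd (hp.dvd_factorial.mp hdvd) (not_le.mpr hk)

/-- If `p > n ≥ 2` and `p ≡ 1 (mod n+1)` then `Ψ₁ = ∏ᵢ D_{p-1,i}` sends `f_n^{p-1}`
to a nonzero constant. -/
theorem Psi_one_fermat_eq_nonzero_const (p n : ℕ) (hp : p.Prime) (hn : 2 ≤ n)
    (hpn : n < p) (hmod : p % (n + 1) = 1) :
    ∃ c : ZMod p, c ≠ 0 ∧ Psi p n (p - 1) ((fermat p n) ^ (p - 1)) = C c := by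
  obtain ⟨m, hm⟩ : n + 1 ∣ p - 1 := (Nat.modEq_iff_dvd' hp.one_le).mp
    (by rw [Nat.ModEq, hmod, Nat.mod_eq_of_lt (by omega)])
  refine ⟨(Nat.multinomial Finset.univ fun _ : Fin (n + 1) => m : ZMod p),
    natCast_multinomial_ne_zero hp _ _ ?_, ?_⟩
  · have := hp.pos
    simp only [Finset.sum_const, Finset.card_univ, Fintype.card_fin, smul_eq_mul]
    omega
  · ext e
    rw [coeff_Psi, coeff_C]
    split_ifs with he
    · subst he
      rw [zero_add, hm, coeff_fermat_pow]
      simp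
    · rw [((isHomogeneous_fermat p n).pow (p - 1)).coeff_eq_zero, mul_zero]
      intro hdeg
      refine he (Finsupp.degree_eq_zero_iff e |>.mp ?_).symm
      rw [map_add, Finsupp.degree_eq_sum (Finsupp.equivFunOnFinite.symm _)] at hdeg
      simpa using hdeg
end

section
/- Let p be a prime with p > n ≥ 2, and set α = (n+1)(p²−1) − n(n+1)p. Then for every j ∈ {0,…,n}, the monomial m_j = x_j^{α} · ∏_{i≠j} x_i^{(n+1)p} appears with nonzero coefficient in f_n^{p²−1} ∈ 𝔽_p[x₀,…,x_n]; equivalently, the multinomial coefficient (p²−1)! / ((p!)^{n} · (p²−1−np)!) is not divisible by p. -/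
open MvPolynomial

open scoped Nat

/-- The exponent vector with entry `p² - 1 - n p` at `j` and `p` elsewhere; the exponent of
`m_j` is `n + 1` times it. -/
noncomputable def reducedExponent (p n : ℕ) (j : Fin (n + 1)) : Fin (n + 1) →₀ ℕ :=
  Finsupp.equivFunOnFinite.symm fun i => if i = j then p ^ 2 - 1 - n * p else p

lemma reducedExponent_apply (p n : ℕ) (j i : Fin (n + 1)) :
    reducedExponent p n j i = if i = j then p ^ 2 - 1 - n * p else p := rfl

lemma mul_le_sq_sub_one {p n : ℕ} (hp : 0 < p) (hpn : n < p) : n * p ≤ p ^ 2 - 1 := by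
  have : (n + 1) * p ≤ p * p := Nat.mul_le_mul_right p hpn
  rw [sq, Nat.le_sub_one_iff_lt (by positivity)]
  nlinarith

lemma sum_reducedExponent {p n : ℕ} (hp : 0 < p) (hpn : n < p) (j : Fin (n + 1)) :
    ∑ i, reducedExponent p n j i = p ^ 2 - 1 := by
  rw [← Finset.add_sum_erase _ _ (Finset.mem_univ j)]
  rw [Finset.sum_congr rfl (g := fun _ => p)
    fun i hi => by rw [reducedExponent_apply, if_neg (Finset.ne_of_mem_erase hi)]]
  simp [reducedExponent_apply, Nat.sub_add_cancel (mul_le_sq_sub_one hp hpn)]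

lemma prod_factorial_reducedExponent (p n : ℕ) (j : Fin (n + 1)) :
    ∏ i, (reducedExponent p n j i)! = p ! ^ n * (p ^ 2 - 1 - n * p)! := by
  rw [← Finset.mul_prod_erase _ _ (Finset.mem_univ j)]
  rw [Finset.prod_congr rfl (g := fun _ => p !)
    fun i hi => by rw [reducedExponent_apply, if_neg (Finset.ne_of_mem_erase hi)]]
  simp [reducedExponent_apply, mul_comm]

lemma multinomial_reducedExponent {p n : ℕ} (hp : 0 < p) (hpn : n < p) (j : Fin (n + 1)) :
    (reducedExponent p n j).multinomial =
      (p ^ 2 - 1)! / (p ! ^ n * (p ^ 2 - 1 - n * p)!) := by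
  rw [← Finsupp.multinomial_of_support_subset (Finset.subset_univ _), Nat.multinomial,
    sum_reducedExponent hp hpn, prod_factorial_reducedExponent]

lemma padicValNat_factorial_mul_add_of_lt {p a b : ℕ} [Fact p.Prime] (ha : a < p) (hb : b < p) :
    padicValNat p (p * a + b)! = a := by
  rw [padicValNat_factorial_mul_add a hb, padicValNat_factorial_mul,
    padicValNat.eq_zero_of_not_dvd, zero_add]
  rw [(Fact.out : p.Prime).dvd_factorial]
  lia

lemma not_dvd_factorial_div {p n : ℕ} (hp : p.Prime) (hpn : n < p) :
    ¬ p ∣ (p ^ 2 - 1)! / (p ! ^ n * (p ^ 2 - 1 - n * p)!) := by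
  have : Fact p.Prime := ⟨hp⟩
  have hdvd : p ! ^ n * (p ^ 2 - 1 - n * p)! ∣ (p ^ 2 - 1)! := by
    have := Nat.prod_factorial_dvd_factorial_sum Finset.univ (reducedExponent p n 0)
    rwa [prod_factorial_reducedExponent, sum_reducedExponent hp.pos hpn] at this
  have hq : (p ^ 2 - 1)! / (p ! ^ n * (p ^ 2 - 1 - n * p)!) ≠ 0 :=
    (Nat.div_pos (Nat.le_of_dvd (Nat.factorial_pos _) hdvd) (by positivity)).ne'
  have htop : p ^ 2 - 1 = p * (p - 1) + (p - 1) := by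
    obtain ⟨q, rfl⟩ := Nat.exists_eq_add_of_lt hp.pos
    simp only [zero_add, Nat.add_sub_cancel]
    rw [Nat.sub_eq_iff_eq_add (Nat.one_le_pow _ (q + 1) q.succ_pos)]
    ring
  have hsub : p ^ 2 - 1 - n * p = p * (p - 1 - n) + (p - 1) := by
    obtain ⟨q, hq⟩ := Nat.exists_eq_add_of_lt hpn
    have hq' : p - 1 - n = q := by lia
    rw [htop, hq', show p - 1 = n + q by lia, Nat.sub_eq_iff_eq_add (by nlinarith)]
    ring
  have hpfac : padicValNat p p ! = 1 := by
    simpa using padicValNat_factorial_mul_add_of_lt (p := p) hp.one_lt hp.pos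
  have hlt : p - 1 < p := Nat.sub_one_lt hp.ne_zero
  have htopval : padicValNat p (p ^ 2 - 1)! = p - 1 := by
    rw [htop, padicValNat_factorial_mul_add_of_lt hlt hlt]
  have hsubval : padicValNat p (p ^ 2 - 1 - n * p)! = p - 1 - n := by
    rw [hsub, padicValNat_factorial_mul_add_of_lt (by lia) hlt]
  have hval := congrArg (padicValNat p) (Nat.mul_div_cancel' hdvd)
  rw [padicValNat.mul (by positivity) hq, padicValNat.mul (by positivity) (by positivity),
    padicValNat.pow, hpfac, hsubval, htopval] at hval
  intro h
  have := one_le_padicValNat_of_dvd hq h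
  lia

lemma fermat_eq_expand (p n : ℕ) :
    fermat p n = expand (n + 1) (∑ i : Fin (n + 1), X i) := by
  simp [fermat]

lemma coeff_fermat_pow_s8 (p n m : ℕ) (d : Fin (n + 1) →₀ ℕ) (hd : ∑ i, d i = m) :
    coeff ((n + 1) • d) (fermat p n ^ m) = (d.multinomial : ZMod p) := by
  rw [fermat_eq_expand, ← map_pow, coeff_expand_smul _ n.succ_ne_zero, coeff_sum_X_pow_of_fintype,
    if_pos]
  rw [← hd, Finsupp.sum_fintype _ _ fun _ => rfl]

/-- For `p > n ≥ 2` and `α = (n+1)(p²-1) - n(n+1)p`, the monomial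
`m_j = x_j^α · ∏_{i≠j} x_i^{(n+1)p}` appears with nonzero coefficient in `f_n^{p²-1}`;
equivalently the multinomial coefficient `(p²-1)! / ((p!)^n (p²-1-np)!)` is not
divisible by `p`. -/
theorem fermat_mj_monomial_nonzero (p n : ℕ) (hp : p.Prime) (hn : 2 ≤ n)
    (hpn : n < p) (j : Fin (n + 1)) :
    MvPolynomial.coeff
        (Finsupp.equivFunOnFinite.symm fun i : Fin (n + 1) =>
          if i = j then (n + 1) * (p ^ 2 - 1) - n * (n + 1) * p else (n + 1) * p)
        ((fermat p n) ^ (p ^ 2 - 1)) ≠ 0 ∧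
    ¬ p ∣ Nat.factorial (p ^ 2 - 1) /
        ((Nat.factorial p) ^ n * Nat.factorial (p ^ 2 - 1 - n * p)) := by
  have hexp : (Finsupp.equivFunOnFinite.symm fun i : Fin (n + 1) =>
      if i = j then (n + 1) * (p ^ 2 - 1) - n * (n + 1) * p else (n + 1) * p) =
      (n + 1) • reducedExponent p n j := by
    ext i
    rw [Finsupp.smul_apply, reducedExponent_apply, Finsupp.equivFunOnFinite_symm_apply_apply]
    split_ifs
    · rw [smul_eq_mul, Nat.mul_sub _ (p ^ 2 - 1), ← mul_assoc, mul_comm n]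
    · rfl
  have hndvd := not_dvd_factorial_div hp hpn
  refine ⟨?_, hndvd⟩
  rw [hexp, coeff_fermat_pow_s8 p n _ _ (sum_reducedExponent hp.pos hpn j), Ne,
    ZMod.natCast_eq_zero_iff, multinomial_reducedExponent hp.pos hpn]
  exact hndvd
end

section
/- Let p be a prime with p > n ≥ 2. Every monomial x₀^{d₀}⋯x_n^{d_n} that appears with nonzero coefficient in f_n^{p²−p} ∈ 𝔽_p[x₀,…,x_n] and is different from (x₀x₁⋯x_n)^{p²−p} satisfies d_i ≥ p² for some i ∈ {0,…,n}. Moreover, if p ≢ 1 (mod n+1), then the monomial (x₀x₁⋯x_n)^{p²−p} does not appear in f_n^{p²−p}, so in that case every monomial in the support of f_n^{p²−p} has some exponent at least p². -/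
open MvPolynomial

/-- By Frobenius, `f_n^{p(p-1)}` is a power of the sum of the variables, expanded. -/
theorem fermat_pow_eq_expand (p n : ℕ) [Fact p.Prime] :
    fermat p n ^ (p ^ 2 - p) =
      expand ((n + 1) * p)
        ((∑ i : Fin (n + 1), X i : MvPolynomial (Fin (n + 1)) (ZMod p)) ^ (p - 1)) := by
  have h : p ^ 2 - p = p * (p - 1) := by rw [Nat.mul_sub, sq, mul_one]
  simp only [h, pow_mul, fermat, sum_pow_char, map_pow, map_sum, expand_X]

/-- The exponents occurring in `f_n^{p²-p}` are `(n+1)p` times those of a monomial of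
degree `p - 1`. -/
theorem exists_eq_mul_of_mem_support_fermat_pow {p n : ℕ} [Fact p.Prime]
    {d : Fin (n + 1) →₀ ℕ} (hd : d ∈ (fermat p n ^ (p ^ 2 - p)).support) :
    ∃ e : Fin (n + 1) → ℕ, ∑ i, e i = p - 1 ∧ ∀ i, d i = (n + 1) * p * e i := by
  classical
  rw [fermat_pow_eq_expand] at hd
  obtain ⟨e, he, rfl⟩ := Finset.mem_image.mp (support_expand_subset _ hd)
  have hom : ((∑ i : Fin (n + 1), X i : MvPolynomial (Fin (n + 1)) (ZMod p)) ^
      (p - 1)).IsHomogeneous (p - 1) := by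
    simpa using (IsHomogeneous.sum Finset.univ _ 1
      fun i _ => isHomogeneous_X (ZMod p) i).pow (p - 1)
  refine ⟨e, ?_, fun i => by simp⟩
  rw [← Finsupp.degree_eq_sum]
  by_contra hne
  exact mem_support_iff.mp he (hom.coeff_eq_zero hne)

/-- A monomial of `f_n^{p²-p}` with all exponents below `p²` is `(x₀⋯x_n)^{p²-p}`, and
then `p - 1` is divisible by `n + 1`. -/
theorem eq_and_dvd_of_mem_support_fermat_pow {p n : ℕ} [Fact p.Prime]
    {d : Fin (n + 1) →₀ ℕ} (hd : d ∈ (fermat p n ^ (p ^ 2 - p)).support)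
    (hlt : ∀ i, d i < p ^ 2) : (∀ i, d i = p ^ 2 - p) ∧ n + 1 ∣ p - 1 := by
  have hp : 0 < p := (Fact.out : p.Prime).pos
  obtain ⟨e, hsum, hde⟩ := exists_eq_mul_of_mem_support_fermat_pow hd
  have hle : ∀ i ∈ Finset.univ, (n + 1) * e i ≤ p - 1 := fun i _ => by
    have h := hlt i
    rw [hde i] at h
    have : (n + 1) * e i < p := by
      by_contra! hc
      nlinarith
    omega
  have heq : ∀ i, (n + 1) * e i = p - 1 := by
    have := (Finset.sum_eq_sum_iff_of_le hle).mp (by simp [← Finset.mul_sum, hsum])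
    exact fun i => this i (Finset.mem_univ i)
  refine ⟨fun i => ?_, ⟨e 0, (heq 0).symm⟩⟩
  rw [hde i, mul_right_comm, heq i, Nat.sub_mul, sq, one_mul]

/-- Every monomial in the support of `f_n^{p²-p}` other than `(x₀⋯x_n)^{p²-p}` has
some exponent `≥ p²`; and if `p ≢ 1 (mod n+1)` then `(x₀⋯x_n)^{p²-p}` does not
appear in `f_n^{p²-p}`, so every monomial in the support has some exponent `≥ p²`. -/
theorem fermat_support_large_exponent (p n : ℕ) (hp : p.Prime) (hn : 2 ≤ n)
    (hpn : n < p) :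
    (∀ d : Fin (n + 1) →₀ ℕ, d ∈ ((fermat p n) ^ (p ^ 2 - p)).support →
        d ≠ Finsupp.equivFunOnFinite.symm (fun _ : Fin (n + 1) => p ^ 2 - p) →
        ∃ i : Fin (n + 1), p ^ 2 ≤ d i) ∧
    (p % (n + 1) ≠ 1 →
      MvPolynomial.coeff (Finsupp.equivFunOnFinite.symm fun _ : Fin (n + 1) => p ^ 2 - p)
          ((fermat p n) ^ (p ^ 2 - p)) = 0 ∧
      ∀ d : Fin (n + 1) →₀ ℕ, d ∈ ((fermat p n) ^ (p ^ 2 - p)).support →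
        ∃ i : Fin (n + 1), p ^ 2 ≤ d i) := by
  have : Fact p.Prime := ⟨hp⟩
  refine ⟨fun d hd hne => ?_, fun hmod => ?_⟩
  · by_contra! hlt
    exact hne (Finsupp.ext (eq_and_dvd_of_mem_support_fermat_pow hd hlt).1)
  · have large : ∀ d ∈ (fermat p n ^ (p ^ 2 - p)).support, ∃ i, p ^ 2 ≤ d i := by
      intro d hd
      by_contra! hlt
      obtain ⟨k, hk⟩ := (eq_and_dvd_of_mem_support_fermat_pow hd hlt).2
      apply hmod
      rw [show p = 1 + (n + 1) * k by have := hp.pos; omega, Nat.add_mul_mod_self_left,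
        Nat.mod_eq_of_lt (by omega)]
    refine ⟨?_, large⟩
    by_contra hne
    obtain ⟨i, hi⟩ := large _ (mem_support_iff.mpr hne)
    have : p ^ 2 ≤ p ^ 2 - p := hi
    have := hp.pos
    have := Nat.pow_pos (n := 2) hp.pos
    omega
end

section
/- Let p be a prime with p > n ≥ 2, let j ∈ {0,…,n}, and set α = (n+1)(p²−1) − n(n+1)p, β = p²−1−(n+1)p and γ = 2p²−1−α; assume β ≥ 0 and γ ≥ 0. Let m_j = x_j^{α} · ∏_{i≠j} x_i^{(n+1)p} and u_j = x_j^{γ} · ∏_{i≠j} x_i^{β}. Then in 𝔽_p[x₀,…,x_n] one has (D_{p²−1,0} ∘ D_{p²−1,1} ∘ ⋯ ∘ D_{p²−1,n})(u_j · m_j) = binom(2p²−1, p²−1) · x_j^{p²}, and the binomial coefficient binom(2p²−1, p²−1) is not divisible by p; that is, the operator δ_j = u_j-multiplication followed by ∏_{i=0}^{n} D_{p²−1,i} sends m_j to a nonzero scalar multiple of x_j^{p²}. -/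
open MvPolynomial

theorem Dop_monomial (p n t : ℕ) (i : Fin (n + 1)) (d : Fin (n + 1) →₀ ℕ) (c : ZMod p) :
    Dop p n t i (monomial d c) =
      monomial (d - Finsupp.single i t) ((((d i).choose t : ℕ) : ZMod p) * c) := by
  classical
  by_cases hc : c = 0
  · simp [Dop, hc]
  · rw [Dop, support_monomial, if_neg hc, Finset.sum_singleton, coeff_monomial, if_pos rfl]
    split_ifs with h
    · rfl
    · simp [Nat.choose_eq_zero_of_lt (not_le.mp h)]

theorem sum_map_single_apply_of_notMem {ι : Type*} (t : ℕ) {l : List ι} {i : ι} (hi : i ∉ l) :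
    (l.map fun k => Finsupp.single k t).sum i = 0 := by
  induction l with
  | nil => simp
  | cons k l ih =>
    simp only [List.mem_cons, not_or] at hi
    simp [ih hi.2, Finsupp.single_eq_of_ne hi.1]

theorem foldr_Dop_monomial (p n t : ℕ) (l : List (Fin (n + 1))) (hl : l.Nodup)
    (d : Fin (n + 1) →₀ ℕ) (c : ZMod p) :
    (l.map fun i => Dop p n t i).foldr (· ∘ ·) id (monomial d c) =
      monomial (d - (l.map fun i => Finsupp.single i t).sum)
        ((l.map fun i => (((d i).choose t : ℕ) : ZMod p)).prod * c) := by
  induction l with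
  | nil => simp
  | cons i l ih =>
    obtain ⟨hi, hl⟩ := List.nodup_cons.mp hl
    have hsum := sum_map_single_apply_of_notMem t hi
    simp only [List.map_cons, List.foldr_cons, Function.comp_apply, List.sum_cons,
      List.prod_cons]
    rw [ih hl, Dop_monomial, Finsupp.tsub_apply, hsum, tsub_zero, tsub_tsub,
      add_comm (Finsupp.single i t), mul_assoc]

theorem Psi_monomial (p n t : ℕ) (d : Fin (n + 1) →₀ ℕ) (c : ZMod p) :
    Psi p n t (monomial d c) =
      monomial (d - ∑ i, Finsupp.single i t) ((∏ i, (((d i).choose t : ℕ) : ZMod p)) * c) := by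
  rw [Psi, List.ofFn_eq_map, foldr_Dop_monomial p n t _ (List.nodup_finRange _),
    ← List.ofFn_eq_map, ← List.ofFn_eq_map, List.sum_ofFn, List.prod_ofFn]

theorem prod_X_pow_eq_monomial_equivFunOnFinite {R : Type*} [CommSemiring R] {m : ℕ}
    (e : Fin m → ℕ) :
    (∏ i, X i ^ e i : MvPolynomial (Fin m) R) =
      monomial (Finsupp.equivFunOnFinite.symm e) 1 := by
  rw [monomial_eq, Finsupp.prod_fintype _ _ (by simp)]
  simp

theorem choose_mul_add_pred_modEq (p a b : ℕ) (hp : p.Prime) :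
    (p * a + (p - 1)).choose (p * b + (p - 1)) ≡ a.choose b [MOD p] := by
  have := Fact.mk hp
  have hlt : p - 1 < p := Nat.sub_lt hp.pos one_pos
  have h := Choose.choose_modEq_choose_mod_mul_choose_div_nat
    (n := p * a + (p - 1)) (k := p * b + (p - 1)) (p := p)
  simpa [Nat.mul_add_mod, Nat.mul_add_div hp.pos, Nat.mod_eq_of_lt hlt,
    Nat.div_eq_of_lt hlt] using h

theorem not_dvd_choose_two_mul_sq_sub_one (p : ℕ) (hp : p.Prime) :
    ¬ p ∣ (2 * p ^ 2 - 1).choose (p ^ 2 - 1) := by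
  obtain ⟨q, rfl⟩ : ∃ q, p = q + 1 := ⟨p - 1, (Nat.sub_add_cancel hp.pos).symm⟩
  have h := (choose_mul_add_pred_modEq (q + 1) ((q + 1) * 1 + q) ((q + 1) * 0 + q) hp).trans
    (choose_mul_add_pred_modEq (q + 1) 1 0 hp)
  have htop : 2 * (q + 1) ^ 2 - 1 = (q + 1) * ((q + 1) * 1 + q) + (q + 1 - 1) := by
    rw [Nat.add_sub_cancel, Nat.sub_eq_iff_eq_add (by ring_nf; omega)]
    ring
  have hbot : (q + 1) ^ 2 - 1 = (q + 1) * ((q + 1) * 0 + q) + (q + 1 - 1) := by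
    rw [Nat.add_sub_cancel, Nat.sub_eq_iff_eq_add (by ring_nf; omega)]
    ring
  rw [htop, hbot, h.dvd_iff dvd_rfl, Nat.choose_zero_right, Nat.dvd_one]
  exact hp.ne_one

/-- For `p > n ≥ 2`, `j ∈ {0,…,n}`, and `α = (n+1)(p²-1) - n(n+1)p`,
`β = p²-1-(n+1)p ≥ 0`, `γ = 2p²-1-α ≥ 0` (the nonnegativity assumptions are encoded
by the defining equations over `ℕ`), the operator
`δ_j = (∏ᵢ D_{p²-1,i}) ∘ (multiplication by u_j)` with `u_j = x_j^γ ∏_{i≠j} x_i^β`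
sends `m_j = x_j^α ∏_{i≠j} x_i^{(n+1)p}` to `binom(2p²-1, p²-1) · x_j^{p²}`,
and `binom(2p²-1, p²-1)` is not divisible by `p`. -/
theorem delta_j_on_mj (p n : ℕ) (hp : p.Prime) (hn : 2 ≤ n) (hpn : n < p)
    (j : Fin (n + 1)) (α β γ : ℕ)
    (hα : α + n * (n + 1) * p = (n + 1) * (p ^ 2 - 1))
    (hβ : β + ((n + 1) * p + 1) = p ^ 2)
    (hγ : γ + α = 2 * p ^ 2 - 1) :
    Psi p n (p ^ 2 - 1)
        ((∏ i : Fin (n + 1), X i ^ (if i = j then γ else β)) *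
          (∏ i : Fin (n + 1), X i ^ (if i = j then α else (n + 1) * p)))
      = C (((2 * p ^ 2 - 1).choose (p ^ 2 - 1) : ℕ) : ZMod p) * X j ^ (p ^ 2) ∧
    ¬ p ∣ (2 * p ^ 2 - 1).choose (p ^ 2 - 1) := by
  refine ⟨?_, not_dvd_choose_two_mul_sq_sub_one p hp⟩
  have hpos : 0 < p ^ 2 := pow_pos hp.pos 2
  have hexp : ∀ i : Fin (n + 1),
      (if i = j then γ else β) + (if i = j then α else (n + 1) * p) =
        if i = j then 2 * p ^ 2 - 1 else p ^ 2 - 1 := by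
    intro i
    split_ifs <;> omega
  rw [← Finset.prod_mul_distrib]
  simp only [← pow_add, hexp]
  rw [prod_X_pow_eq_monomial_equivFunOnFinite, Psi_monomial, C_mul_X_pow_eq_monomial]
  refine congrArg₂ (fun d c => monomial d c) ?_ ?_
  · ext i
    simp only [Finsupp.tsub_apply, Finsupp.equivFunOnFinite_symm_apply_apply,
      Finsupp.finsetSum_apply, Finsupp.single_apply, Finset.sum_ite_eq', Finset.mem_univ,
      if_true, eq_comm (a := j)]
    split_ifs <;> omega
  · rw [mul_one, Finset.prod_eq_single j]
    · simp
    · intro i _ hij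
      simp [hij]
    · simp
end
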